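/- Let A = [[m,0,0],[0,a,b],[0,c,d]] with m > 1 an integer, ad − bc = 1, and [[a,b],[c,d]] having an eigenvalue λ > 1, with m > λ. Then for T(x) = Ax (mod 1) on 𝕋³ and τ > 0, dim_H R_τ = min{ (τ+3log λ)/(τ+log λ), 3log m/(τ+log m), (2log λ+log m)/(τ+log λ), (log λ+log m)/τ, (τ+log λ)/τ }. -/

import Mathlib

open Filter MeasureTheory

noncomputable def intVec3 (z : Fin 3 → ℤ) : EuclideanSpace ℝ (Fin 3) :=
  (WithLp.equiv 2 (Fin 3 → ℝ)).symm fun i => (z i : ℝ)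

/-- The lift to `ℝ³` of the recurrence set
`R_τ = {x ∈ 𝕋³ : Tⁿx ∈ B(x, e^{-nτ}) for infinitely many n}`, `T x = A x (mod 1)`. -/
noncomputable def recSet3 (A : Matrix (Fin 3) (Fin 3) ℤ) (τ : ℝ) :
    Set (EuclideanSpace ℝ (Fin 3)) :=
  {x | ∃ᶠ n : ℕ in atTop, ∃ z : Fin 3 → ℤ,
    ‖Matrix.toEuclideanLin ((A ^ n).map (Int.cast : ℤ → ℝ)) x - x - intVec3 z‖
      < Real.exp (-(n : ℝ) * τ)}

/-- `A` is covered by at most `N` closed balls of radius `r`. -/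
def IsCoveredBy {X : Type*} [PseudoMetricSpace X] (A : Set X) (r N : ℝ) : Prop :=
  ∃ F : Finset X, (F.card : ℝ) ≤ N ∧ A ⊆ ⋃ x ∈ F, Metric.closedBall x r

theorem dimH_frequently_mem_le {X : Type*} [MetricSpace X] (A : ℕ → Set X) {C a t : ℝ}
    (hC : 0 ≤ C) (ht : 0 < t)
    (hA : ∀ᶠ n : ℕ in atTop, IsCoveredBy (A n) (Real.exp (-n * t)) (C * Real.exp (n * a))) :
    dimH {x | ∃ᶠ n in atTop, x ∈ A n} ≤ ENNReal.ofReal (a / t) := by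
  borelize X
  refine dimH_le fun s hs => ?_
  by_contra! hlt
  have hat : a / t < s := by
    rw [← ENNReal.ofReal_coe_nnreal] at hlt
    exact (ENNReal.ofReal_lt_ofReal_iff'.1 hlt).1
  have hq : a - t * s < 0 := by
    rw [div_lt_iff₀ ht] at hat; linarith
  obtain ⟨N₀, hN₀⟩ := eventually_atTop.1 hA
  have hF : ∀ n : ℕ, ∃ F : Finset X, N₀ ≤ n → (F.card : ℝ) ≤ C * Real.exp (n * a) ∧
      A n ⊆ ⋃ x ∈ F, Metric.closedBall x (Real.exp (-n * t)) := by
    intro n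
    by_cases h : N₀ ≤ n
    · obtain ⟨F, hF⟩ := hN₀ n h
      exact ⟨F, fun _ => hF⟩
    · exact ⟨∅, fun h' => absurd h' h⟩
  choose F hF using hF
  set g : ℕ → ENNReal := fun n =>
    ENNReal.ofReal (C * 2 ^ (s : ℝ) * Real.exp (a - t * s) ^ n) with hg
  have hgsum : ∑' n, g n ≠ ⊤ := by
    have hsum : Summable fun n : ℕ => C * 2 ^ (s : ℝ) * Real.exp (a - t * s) ^ n :=
      (summable_geometric_of_lt_one (Real.exp_pos _).le (by simpa using hq)).mul_left _
    rw [hg, ← ENNReal.ofReal_tsum_of_nonneg (fun n => by positivity) hsum]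
    exact ENNReal.ofReal_ne_top
  have hdiam : ∀ (n : ℕ) (x : X), Metric.ediam (Metric.closedBall x (Real.exp (-n * t)))
      ≤ ENNReal.ofReal (2 * Real.exp (-n * t)) := by
    intro n x
    rw [← Metric.closedEBall_ofReal (Real.exp_pos _).le, ENNReal.ofReal_mul zero_le_two,
      ENNReal.ofReal_ofNat]
    exact Metric.ediam_closedEBall_le
  have hzero : μH[(s : ℝ)] {x | ∃ᶠ n in atTop, x ∈ A n} ≤ 0 := by
    refine (Measure.hausdorffMeasure_le_liminf_tsum (β := ℕ) (ι := fun N => Σ n : ℕ, F (n + N))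
      (s : ℝ) _ (l := atTop) (fun N : ℕ => ENNReal.ofReal (2 * Real.exp (-N * t))) ?_
      (fun N i => Metric.closedBall i.2.1 (Real.exp (-(i.1 + N : ℕ) * t))) ?_ ?_).trans ?_
    · rw [← ENNReal.ofReal_zero]
      refine ENNReal.tendsto_ofReal ?_
      rw [← mul_zero (2 : ℝ)]
      refine Tendsto.const_mul _ (Real.tendsto_exp_atBot.comp ?_)
      simp_rw [neg_mul]
      exact tendsto_neg_atTop_atBot.comp (tendsto_natCast_atTop_atTop.atTop_mul_const ht)
    · refine Eventually.of_forall fun N i => (hdiam _ _).trans (ENNReal.ofReal_le_ofReal ?_)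
      gcongr
      omega
    · filter_upwards [eventually_ge_atTop N₀] with N hN x hx
      obtain ⟨n, hn, hxn⟩ := (frequently_atTop.1 hx) N
      have := (hF n (hN.trans hn)).2 hxn
      simp only [Set.mem_iUnion, exists_prop] at this ⊢
      obtain ⟨y, hy, hxy⟩ := this
      obtain ⟨k, rfl⟩ := Nat.exists_eq_add_of_le' hn
      exact ⟨⟨k, ⟨y, hy⟩⟩, hxy⟩
    · have hle : ∀ᶠ N : ℕ in atTop,
          (∑' i : Σ n : ℕ, F (n + N),
            Metric.ediam (Metric.closedBall i.2.1 (Real.exp (-(i.1 + N : ℕ) * t))) ^ (s : ℝ))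
            ≤ ∑' n, g (n + N) := by
        filter_upwards [eventually_ge_atTop N₀] with N hN
        rw [ENNReal.tsum_sigma']
        refine ENNReal.tsum_le_tsum fun n => ?_
        calc (∑' i : F (n + N),
            Metric.ediam (Metric.closedBall i.1 (Real.exp (-(n + N : ℕ) * t))) ^ (s : ℝ))
            ≤ ∑' i : F (n + N), ENNReal.ofReal (2 * Real.exp (-(n + N : ℕ) * t)) ^ (s : ℝ) :=
              ENNReal.tsum_le_tsum fun i => ENNReal.rpow_le_rpow (hdiam _ _) s.coe_nonneg
          _ = ENNReal.ofReal ((F (n + N)).card * (2 * Real.exp (-(n + N : ℕ) * t)) ^ (s : ℝ)) := by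
              rw [tsum_fintype, Finset.sum_const, Finset.card_univ, Fintype.card_coe,
                nsmul_eq_mul, ENNReal.ofReal_rpow_of_nonneg (by positivity) s.coe_nonneg,
                ENNReal.ofReal_mul (Nat.cast_nonneg _), ENNReal.ofReal_natCast]
          _ ≤ g (n + N) := by
              refine ENNReal.ofReal_le_ofReal ?_
              have h1 := (hF (n + N) (by omega)).1
              calc ((F (n + N)).card : ℝ) * (2 * Real.exp (-(n + N : ℕ) * t)) ^ (s : ℝ)
                  ≤ (C * Real.exp ((n + N : ℕ) * a)) *
                    (2 * Real.exp (-(n + N : ℕ) * t)) ^ (s : ℝ) := by gcongr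
                _ = _ := by
                  rw [Real.mul_rpow zero_le_two (Real.exp_pos _).le, ← Real.exp_mul,
                    ← Real.exp_nat_mul, mul_mul_mul_comm, ← Real.exp_add]
                  congr 2
                  ring
      refine (liminf_le_liminf hle).trans ?_
      exact (ENNReal.tendsto_sum_nat_add g hgsum).liminf_eq.le
  rw [hs] at hzero
  simp at hzero

theorem IsCoveredBy.of_subset_biUnion {X κ : Type*} [PseudoMetricSpace X] {A : Set X} {r N M : ℝ}
    (I : Finset κ) (B : κ → Set X) (hI : (I.card : ℝ) ≤ M) (hN : 0 ≤ N)
    (hB : ∀ i ∈ I, IsCoveredBy (B i) r N) (hA : A ⊆ ⋃ i ∈ I, B i) : IsCoveredBy A r (M * N) := by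
  classical
  have hF : ∀ i : κ, ∃ F : Finset X, i ∈ I → (F.card : ℝ) ≤ N ∧
      B i ⊆ ⋃ x ∈ F, Metric.closedBall x r := by
    intro i
    by_cases h : i ∈ I
    · obtain ⟨F, hF⟩ := hB i h
      exact ⟨F, fun _ => hF⟩
    · exact ⟨∅, fun h' => absurd h' h⟩
  choose F hF using hF
  refine ⟨I.biUnion F, ?_, fun x hx => ?_⟩
  · calc ((I.biUnion F).card : ℝ) ≤ ∑ i ∈ I, ((F i).card : ℝ) := by
          exact_mod_cast Finset.card_biUnion_le
      _ ≤ ∑ i ∈ I, N := Finset.sum_le_sum fun i hi => (hF i hi).1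
      _ = I.card * N := by simp
      _ ≤ M * N := by gcongr
  · have := hA hx
    simp only [Set.mem_iUnion, exists_prop, Finset.mem_biUnion] at this ⊢
    obtain ⟨i, hi, hxi⟩ := this
    have := (hF i hi).2 hxi
    simp only [Set.mem_iUnion, exists_prop] at this
    obtain ⟨y, hy, hxy⟩ := this
    exact ⟨y, ⟨i, hi, hy⟩, hxy⟩

theorem isCoveredBy_box {ι : Type*} [Fintype ι] (p ρ : ι → ℝ) {r : ℝ} (hr : 0 < r) :
    IsCoveredBy {w : ι → ℝ | ∀ i, |w i - p i| ≤ ρ i} r (∏ i, (|ρ i| / r + 1)) := by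
  classical
  refine ⟨(Fintype.piFinset fun i => Finset.range (⌊|ρ i| / r⌋₊ + 1)).image
    fun k i => p i - ρ i + (2 * k i + 1) * r, ?_, fun w hw => ?_⟩
  · refine (Nat.cast_le.2 Finset.card_image_le).trans ?_
    rw [Fintype.card_piFinset]
    push_cast
    refine Finset.prod_le_prod (fun i _ => by positivity) fun i _ => ?_
    rw [Finset.card_range]
    push_cast
    gcongr
    exact Nat.floor_le (by positivity)
  · simp only [Set.mem_ofPred_eq, abs_le] at hw
    have h0 : ∀ i, 0 ≤ (w i - p i + ρ i) / (2 * r) := fun i =>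
      div_nonneg (by linarith [(hw i).1]) (by positivity)
    simp only [Set.mem_iUnion, exists_prop, Finset.mem_image, Fintype.mem_piFinset,
      Finset.mem_range]
    refine ⟨_, ⟨fun i => ⌊(w i - p i + ρ i) / (2 * r)⌋₊, fun i => ?_, rfl⟩, ?_⟩
    · refine Nat.lt_succ_of_le (Nat.floor_le_floor ?_)
      rw [div_le_div_iff₀ (by positivity) hr]
      nlinarith [(hw i).2, le_abs_self (ρ i)]
    · rw [Metric.mem_closedBall, dist_pi_le_iff hr.le]
      intro i
      have h1 := Nat.floor_le (h0 i)
      have h2 := Nat.lt_floor_add_one ((w i - p i + ρ i) / (2 * r))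
      rw [le_div_iff₀ (by positivity)] at h1
      rw [div_lt_iff₀ (by positivity)] at h2
      rw [Real.dist_eq, abs_le]
      constructor <;> nlinarith

section Tree

variable {X P κ : Type*}

open Classical in
/-- In the tree of nodes `P` in which `p` at depth `k` has the children `ch k p d`, `d ∈ I k`, the
proportion of descendants `j` generations below `p` whose set `B` meets `U`. -/
noncomputable def meetFraction (I : ℕ → Finset κ) (ch : ℕ → P → κ → P) (B : ℕ → P → Set X)
    (U : Set X) : ℕ → ℕ → P → ℝ
  | 0, k, p => if (B k p ∩ U).Nonempty then 1 else 0
  | j + 1, k, p => (∑ d ∈ I k, meetFraction I ch B U j (k + 1) (ch k p d)) / (I k).card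

/-- The union of the sets `B` of the descendants `j` generations below `p`. -/
def treeLevel (I : ℕ → Finset κ) (ch : ℕ → P → κ → P) (B : ℕ → P → Set X) : ℕ → ℕ → P → Set X
  | 0, k, p => B k p
  | j + 1, k, p => ⋃ d ∈ I k, treeLevel I ch B j (k + 1) (ch k p d)

variable {I : ℕ → Finset κ} {ch : ℕ → P → κ → P} {B : ℕ → P → Set X}

theorem meetFraction_nonneg (U : Set X) (j k : ℕ) (p : P) : 0 ≤ meetFraction I ch B U j k p := by
  induction j generalizing k p with
  | zero => rw [meetFraction]; split_ifs <;> norm_num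
  | succ j ih => rw [meetFraction]; exact div_nonneg (Finset.sum_nonneg fun d _ => ih _ _) (by simp)

theorem meetFraction_succ_le {U : Set X} {j k : ℕ} {b : ℝ} (hI : (I k).Nonempty)
    (h : ∀ q, meetFraction I ch B U j (k + 1) q ≤ b) (p : P) :
    meetFraction I ch B U (j + 1) k p ≤ b := by
  have hc : (0 : ℝ) < (I k).card := by exact_mod_cast hI.card_pos
  rw [meetFraction, div_le_iff₀ hc]
  calc _ ≤ ∑ d ∈ I k, b := Finset.sum_le_sum fun d _ => h _
    _ = b * (I k).card := by simp [mul_comm]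

theorem meetFraction_add_le {U : Set X} (hI : ∀ k, (I k).Nonempty) {j k : ℕ} {b : ℝ}
    (h : ∀ q, meetFraction I ch B U j k q ≤ b) (p : P) :
    meetFraction I ch B U (j + k) 0 p ≤ b := by
  induction k generalizing j with
  | zero => exact h p
  | succ k ih =>
    rw [show j + (k + 1) = j + 1 + k by omega]
    exact ih (meetFraction_succ_le (hI k) h)

theorem meetFraction_le_one {U : Set X} (hI : ∀ k, (I k).Nonempty) (j k : ℕ) (p : P) :
    meetFraction I ch B U j k p ≤ 1 := by
  induction j generalizing k p with
  | zero => rw [meetFraction]; split_ifs <;> norm_num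
  | succ j ih => exact meetFraction_succ_le (hI k) (ih _) p

theorem meetFraction_eq_zero {U : Set X}
    (hB : ∀ k p, ∀ d ∈ I k, B (k + 1) (ch k p d) ⊆ B k p) (j k : ℕ) (p : P)
    (h : ¬(B k p ∩ U).Nonempty) : meetFraction I ch B U j k p = 0 := by
  induction j generalizing k p with
  | zero => rw [meetFraction, if_neg h]
  | succ j ih =>
    rw [meetFraction, Finset.sum_eq_zero, zero_div]
    exact fun d hd => ih _ _ fun h' => h (h'.mono (Set.inter_subset_inter_left _ (hB k p d hd)))

open Classical in
theorem meetFraction_succ_le_mul {U : Set X} (hI : ∀ k, (I k).Nonempty)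
    (hB : ∀ k p, ∀ d ∈ I k, B (k + 1) (ch k p d) ⊆ B k p) {j k : ℕ} {b f : ℝ} {p : P} (hb : 0 ≤ b)
    (h : ∀ q, meetFraction I ch B U j (k + 1) q ≤ b)
    (hf : (((I k).filter fun d => (B (k + 1) (ch k p d) ∩ U).Nonempty).card : ℝ)
      ≤ f * (I k).card) :
    meetFraction I ch B U (j + 1) k p ≤ f * b := by
  have hc : (0 : ℝ) < (I k).card := by exact_mod_cast (hI k).card_pos
  rw [meetFraction, div_le_iff₀ hc]
  calc ∑ d ∈ I k, meetFraction I ch B U j (k + 1) (ch k p d)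
      ≤ ∑ d ∈ I k, if (B (k + 1) (ch k p d) ∩ U).Nonempty then b else 0 := by
        refine Finset.sum_le_sum fun d _ => ?_
        split_ifs with hd
        · exact h _
        · exact (meetFraction_eq_zero hB _ _ _ hd).le
    _ = ((I k).filter fun d => (B (k + 1) (ch k p d) ∩ U).Nonempty).card * b := by
        rw [← Finset.sum_filter]; simp
    _ ≤ f * (I k).card * b := by gcongr
    _ = f * b * (I k).card := by ring

theorem one_le_sum_meetFraction {α : Type*} (S : Finset α) (U : α → Set X)
    (hI : ∀ k, (I k).Nonempty) (hne : ∀ k p, (B k p).Nonempty) (j k : ℕ) (p : P)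
    (h : treeLevel I ch B j k p ⊆ ⋃ a ∈ S, U a) :
    1 ≤ ∑ a ∈ S, meetFraction I ch B (U a) j k p := by
  induction j generalizing k p with
  | zero =>
    obtain ⟨x, hx⟩ := hne k p
    have hx' := h hx
    simp only [Set.mem_iUnion, exists_prop] at hx'
    obtain ⟨a, ha, hxa⟩ := hx'
    refine le_trans ?_ (Finset.single_le_sum (fun a _ => meetFraction_nonneg (U a) 0 k p) ha)
    rw [meetFraction, if_pos ⟨x, hx, hxa⟩]
  | succ j ih =>
    have hc : (0 : ℝ) < (I k).card := by exact_mod_cast (hI k).card_pos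
    simp only [meetFraction]
    rw [← Finset.sum_div, le_div_iff₀ hc, Finset.sum_comm, one_mul]
    calc ((I k).card : ℝ) = ∑ d ∈ I k, (1 : ℝ) := by simp
      _ ≤ _ := Finset.sum_le_sum fun d hd => ih _ _ (le_trans ?_ h)
    rw [treeLevel]
    exact Set.subset_biUnion_of_mem (u := fun d => treeLevel I ch B j (k + 1) (ch k p d)) hd

theorem treeLevel_succ_subset (hB : ∀ k p, ∀ d ∈ I k, B (k + 1) (ch k p d) ⊆ B k p) (j k : ℕ)
    (p : P) : treeLevel I ch B (j + 1) k p ⊆ treeLevel I ch B j k p := by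
  induction j generalizing k p with
  | zero => exact Set.iUnion₂_subset fun d hd => hB k p d hd
  | succ j ih => exact Set.iUnion₂_mono fun d _ => ih _ _

theorem treeLevel_antitone (hB : ∀ k p, ∀ d ∈ I k, B (k + 1) (ch k p d) ⊆ B k p) (k : ℕ)
    (p : P) : Antitone fun j => treeLevel I ch B j k p :=
  antitone_nat_of_succ_le fun j => treeLevel_succ_subset hB j k p

theorem treeLevel_subset {E : ℕ → Set X} (hE : ∀ k p, ∀ d ∈ I k, B (k + 1) (ch k p d) ⊆ E (k + 1))
    (j k : ℕ) (p : P) : treeLevel I ch B (j + 1) k p ⊆ E (k + (j + 1)) := by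
  induction j generalizing k p with
  | zero => exact Set.iUnion₂_subset fun d hd => hE k p d hd
  | succ j ih =>
    refine Set.iUnion₂_subset fun d hd => ?_
    rw [show k + (j + 1 + 1) = k + 1 + (j + 1) by omega]
    exact ih _ _

theorem isCompact_treeLevel [TopologicalSpace X] (hB : ∀ k p, IsCompact (B k p)) (j k : ℕ)
    (p : P) : IsCompact (treeLevel I ch B j k p) := by
  induction j generalizing k p with
  | zero => exact hB k p
  | succ j ih => exact (I k).isCompact_biUnion fun d _ => ih _ _

theorem exists_isOpen_superset_ediam_rpow_le [MetricSpace X] {s r₀ : ℝ} (hs : 0 < s) (hr₀ : 0 < r₀)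
    {t : Set X} (ht : Metric.ediam t ≤ ENNReal.ofReal (r₀ / 2)) {ε : NNReal} (hε : 0 < ε) :
    ∃ (U : Set X) (r : ℝ), IsOpen U ∧ t ⊆ U ∧ 0 < r ∧ r ≤ r₀ ∧
      Metric.ediam U ≤ ENNReal.ofReal r ∧
      ENNReal.ofReal (r ^ s) ≤ (⨆ _ : t.Nonempty, Metric.ediam t ^ s) + ε := by
  set e := (Metric.ediam t).toReal with he
  have htop : Metric.ediam t ≠ ⊤ := ne_top_of_le_ne_top ENNReal.ofReal_ne_top ht
  have he0 : 0 ≤ e := ENNReal.toReal_nonneg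
  have het : ENNReal.ofReal e = Metric.ediam t := ENNReal.ofReal_toReal htop
  have her : e ≤ r₀ / 2 := by
    rw [← het, ENNReal.ofReal_le_ofReal_iff (by positivity)] at ht; exact ht
  have hcont : ContinuousAt (fun x : ℝ => x ^ s) e := Real.continuousAt_rpow_const _ _ (Or.inr hs.le)
  have hev : ∀ᶠ x in nhds e, x ^ s < e ^ s + ε :=
    hcont.eventually_lt continuousAt_const (by simpa using hε)
  obtain ⟨η, hη, hball⟩ := Metric.eventually_nhds_iff.1 hev
  set θ := min (η / 2) (r₀ / 2) with hθ
  have hθ0 : 0 < θ := by positivity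
  refine ⟨Metric.thickening (θ / 2) t, e + θ, Metric.isOpen_thickening,
    Metric.self_subset_thickening (by positivity) t, by positivity, ?_, ?_, ?_⟩
  · linarith [min_le_right (η / 2) (r₀ / 2)]
  · have h := Metric.ediam_thickening_le (s := t) (θ / 2).toNNReal
    rw [Real.coe_toNNReal _ (by positivity)] at h
    refine h.trans ?_
    rw [ENNReal.ofReal_add he0 hθ0.le, het]
    gcongr
    change 2 * ENNReal.ofReal (θ / 2) ≤ _
    rw [← ENNReal.ofReal_ofNat 2, ← ENNReal.ofReal_mul zero_le_two, mul_div_cancel₀ θ two_ne_zero]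
  · have h1 : (e + θ) ^ s ≤ e ^ s + ε := by
      refine (hball ?_).le
      rw [Real.dist_eq, add_sub_cancel_left, abs_of_pos hθ0]
      linarith [min_le_left (η / 2) (r₀ / 2)]
    refine (ENNReal.ofReal_le_ofReal h1).trans ?_
    rw [ENNReal.ofReal_add (by positivity) ε.coe_nonneg, ENNReal.ofReal_coe_nnreal]
    gcongr
    rw [← ENNReal.ofReal_rpow_of_nonneg he0 hs.le, het]
    rcases t.eq_empty_or_nonempty with rfl | hne
    · simp [hs]
    · exact le_iSup_of_le hne le_rfl

theorem one_le_hausdorffMeasure_iInter_treeLevel [MetricSpace X] [MeasurableSpace X] [BorelSpace X]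
    (hI : ∀ k, (I k).Nonempty) (hne : ∀ k p, (B k p).Nonempty) (hcpt : ∀ k p, IsCompact (B k p))
    (hB : ∀ k p, ∀ d ∈ I k, B (k + 1) (ch k p d) ⊆ B k p) (p : P) {s r₀ : ℝ} (hs : 0 < s)
    (hr₀ : 0 < r₀)
    (hmass : ∀ (U : Set X) (r : ℝ), 0 < r → r ≤ r₀ → Metric.ediam U ≤ ENNReal.ofReal r →
      ∃ J, ∀ j, J ≤ j → meetFraction I ch B U j 0 p ≤ r ^ s) :
    1 ≤ μH[s] (⋂ j, treeLevel I ch B j 0 p) := by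
  rw [Measure.hausdorffMeasure_apply]
  refine le_iSup₂_of_le (ENNReal.ofReal (r₀ / 2)) (by simpa using hr₀) ?_
  refine le_iInf fun t => le_iInf fun ht => le_iInf fun hd => ?_
  refine ENNReal.le_of_forall_pos_le_add fun ε hε _ => ?_
  obtain ⟨ε', hε', hsum⟩ := ENNReal.exists_pos_sum_of_countable
    (ENNReal.coe_ne_zero.2 hε.ne') ℕ
  choose U r hUo htU hr hrr₀ hUd hrs using fun n =>
    exists_isOpen_superset_ediam_rpow_le hs hr₀ (hd n) (hε' n)
  choose J hJ using fun n => hmass (U n) (r n) (hr n) (hrr₀ n) (hUd n)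
  have hsub : (⋂ j, treeLevel I ch B j 0 p) ⊆ ⋃ n, U n := ht.trans (Set.iUnion_mono htU)
  obtain ⟨j, hj⟩ := exists_subset_nhds_of_isCompact
    (V := fun j => treeLevel I ch B j 0 p) (treeLevel_antitone hB 0 p).directed_ge
    (fun j => isCompact_treeLevel hcpt j 0 p) (U := ⋃ n, U n)
    (fun x hx => (isOpen_iUnion hUo).mem_nhds (hsub hx))
  obtain ⟨S, hS⟩ := (isCompact_treeLevel hcpt j 0 p).elim_finite_subcover U hUo hj
  set j' := max j (S.sup J) with hj'
  have h1 : 1 ≤ ∑ n ∈ S, r n ^ s :=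
    (one_le_sum_meetFraction S U hI hne j' 0 p
      ((treeLevel_antitone hB 0 p (le_max_left _ _)).trans hS)).trans
      (Finset.sum_le_sum fun n hn => hJ n j' ((Finset.le_sup hn).trans (le_max_right _ _)))
  calc (1 : ENNReal) ≤ ENNReal.ofReal (∑ n ∈ S, r n ^ s) := by simpa using h1
    _ = ∑ n ∈ S, ENNReal.ofReal (r n ^ s) :=
        ENNReal.ofReal_sum_of_nonneg fun n _ => Real.rpow_nonneg (hr n).le _
    _ ≤ ∑' n, ENNReal.ofReal (r n ^ s) := ENNReal.sum_le_tsum S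
    _ ≤ ∑' n, ((⨆ _ : (t n).Nonempty, Metric.ediam (t n) ^ s) + ε' n) :=
        ENNReal.tsum_le_tsum hrs
    _ ≤ _ := by rw [ENNReal.tsum_add]; gcongr

end Tree

theorem Int.card_le_of_forall_mem_le {S : Finset ℤ} {a b : ℝ} (hab : a ≤ b + 1)
    (h : ∀ z ∈ S, a ≤ z ∧ z ≤ b) : (S.card : ℝ) ≤ b - a + 1 := by
  have hS : S ⊆ Finset.Icc ⌈a⌉ ⌊b⌋ := fun z hz =>
    Finset.mem_Icc.2 ⟨Int.ceil_le.2 (h z hz).1, Int.le_floor.2 (h z hz).2⟩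
  have h1 : (S.card : ℤ) ≤ max (⌊b⌋ + 1 - ⌈a⌉) 0 := by
    rw [← Int.ofNat_toNat, ← Int.card_Icc]
    exact_mod_cast Finset.card_le_card hS
  have h2 : (S.card : ℝ) ≤ max ((⌊b⌋ : ℝ) + 1 - ⌈a⌉) 0 := by exact_mod_cast h1
  refine h2.trans (max_le ?_ (by linarith))
  linarith [Int.floor_le b, Int.le_ceil a]

section Boxes

variable {ι : Type*} [Fintype ι]

open Classical in
theorem card_filter_box_meet_le {p ρ δ ρ' : ι → ℝ} {U : Set (ι → ℝ)} {r : ℝ} (hr : 0 < r)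
    (hU : Metric.ediam U ≤ ENNReal.ofReal r) (hρ : ∀ i, 0 < ρ i) (hδ : ∀ i, 0 < δ i)
    (hρ' : ∀ i, ρ' i ≤ δ i) (hfit : ∀ i, 3 * δ i ≤ 2 * ρ i) (q : (ι → ℕ) → ι → ℝ)
    (hq : ∀ d i, p i + 3 * δ i * d i ≤ q d i ∧ q d i ≤ p i + 3 * δ i * d i + δ i) :
    ((((Fintype.piFinset fun i => Finset.range ⌊2 * ρ i / (3 * δ i)⌋₊).filter
      fun d => ({w : ι → ℝ | ∀ i, |w i - q d i| ≤ ρ' i} ∩ U).Nonempty).card : ℕ) : ℝ)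
      ≤ (∏ i, min 1 (9 * max (δ i) r / ρ i)) *
        (Fintype.piFinset fun i => Finset.range ⌊2 * ρ i / (3 * δ i)⌋₊).card := by
  rcases U.eq_empty_or_nonempty with rfl | ⟨x, hx⟩
  · have : ∀ i, 0 < ρ i := hρ
    simp only [Set.inter_empty, Set.not_nonempty_empty, Finset.filter_false, Finset.card_empty,
      Nat.cast_zero]
    refine mul_nonneg (Finset.prod_nonneg fun i _ => ?_) (Nat.cast_nonneg _)
    have := hρ i
    positivity
  set N : ι → ℕ := fun i => ⌊2 * ρ i / (3 * δ i)⌋₊ with hN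
  set T : ι → Finset ℕ := fun i => (Finset.range (N i)).filter
    fun d => |p i + 3 * δ i * d - x i + δ i / 2| ≤ r + 3 / 2 * δ i with hT
  have hsub : ((Fintype.piFinset fun i => Finset.range (N i)).filter
      fun d => ({w : ι → ℝ | ∀ i, |w i - q d i| ≤ ρ' i} ∩ U).Nonempty) ⊆ Fintype.piFinset T := by
    intro d hd
    obtain ⟨hd1, w, hw, hwU⟩ := Finset.mem_filter.1 hd
    refine Fintype.mem_piFinset.2 fun i => Finset.mem_filter.2
      ⟨Fintype.mem_piFinset.1 hd1 i, ?_⟩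
    have h1 : dist w x ≤ r := by
      have := (Metric.edist_le_ediam_of_mem hwU hx).trans hU
      rwa [edist_dist, ENNReal.ofReal_le_ofReal_iff hr.le] at this
    have h2 := (dist_le_pi_dist w x i).trans h1
    have h3 := hw i
    have h4 := hq d i
    have h5 := hρ' i
    rw [Real.dist_eq] at h2
    rw [abs_le] at h2 h3 ⊢
    constructor <;> linarith
  have hcard : ∀ i, ((T i).card : ℝ) ≤ min 1 (9 * max (δ i) r / ρ i) * N i := by
    intro i
    have hδi := hδ i
    have hρi := hρ i
    have h1 : ((T i).card : ℝ) ≤ N i := by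
      have := Finset.card_filter_le (Finset.range (N i))
        fun d : ℕ => |p i + 3 * δ i * d - x i + δ i / 2| ≤ r + 3 / 2 * δ i
      rw [Finset.card_range] at this
      exact_mod_cast this
    have h2 : ((T i).card : ℝ) ≤ 3 * max (δ i) r / δ i := by
      have h := Int.card_le_of_forall_mem_le (S := (T i).map Nat.castEmbedding)
        (a := (x i - p i - 2 * δ i - r) / (3 * δ i)) (b := (x i - p i + δ i + r) / (3 * δ i)) ?_ ?_
      · rw [Finset.card_map] at h
        refine h.trans ?_
        rw [← sub_div, div_add_one (by positivity), div_le_div_iff₀ (by positivity) hδi]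
        nlinarith [le_max_left (δ i) r, le_max_right (δ i) r]
      · rw [div_add_one (by positivity)]
        gcongr
        linarith
      · intro z hz
        obtain ⟨d, hd, rfl⟩ := Finset.mem_map.1 hz
        have := (Finset.mem_filter.1 hd).2
        rw [abs_le] at this
        simp only [Nat.castEmbedding_apply, Int.cast_natCast]
        rw [div_le_iff₀ (by positivity), le_div_iff₀ (by positivity)]
        constructor <;> linarith
    have h3 : ρ i / (3 * δ i) ≤ N i := by
      have h4 : 1 ≤ 2 * ρ i / (3 * δ i) := (one_le_div (by positivity)).2 (hfit i)
      have h5 : (1 : ℝ) ≤ N i := by exact_mod_cast Nat.le_floor (by exact_mod_cast h4)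
      have h6 := Nat.lt_floor_add_one (2 * ρ i / (3 * δ i))
      have h7 : 2 * ρ i / (3 * δ i) = 2 * (ρ i / (3 * δ i)) := by ring
      rw [h7] at h6
      have h8 : ((⌊2 * (ρ i / (3 * δ i))⌋₊ : ℕ) : ℝ) = N i := by rw [hN, ← h7]
      linarith
    rw [min_mul_of_nonneg _ _ (Nat.cast_nonneg _), one_mul]
    refine le_min h1 (h2.trans ?_)
    calc 3 * max (δ i) r / δ i = 9 * max (δ i) r / ρ i * (ρ i / (3 * δ i)) := by
          field_simp; norm_num
      _ ≤ _ := by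
        refine mul_le_mul_of_nonneg_left h3 ?_
        positivity
  calc _ ≤ ((Fintype.piFinset T).card : ℝ) := by exact_mod_cast Finset.card_le_card hsub
    _ = ∏ i, ((T i).card : ℝ) := by rw [Fintype.card_piFinset]; push_cast; rfl
    _ ≤ ∏ i, (min 1 (9 * max (δ i) r / ρ i) * N i) :=
        Finset.prod_le_prod (fun i _ => Nat.cast_nonneg _) fun i _ => hcard i
    _ = _ := by
        rw [Finset.prod_mul_distrib, Fintype.card_piFinset]
        push_cast
        simp only [Finset.card_range, hN]

theorem hausdorffMeasure_setOf_forall_mem_ne_zero [Nonempty ι] (E : ℕ → Set (ι → ℝ))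
    (δ ρ : ℕ → ι → ℝ) (D : ℕ → ℝ) {s : ℝ} (hs : 0 < s) (hρ : ∀ k i, 0 < ρ k i)
    (hρδ : ∀ k i, ρ k i ≤ δ k i) (hδD : ∀ k i, δ k i ≤ D k) (hD : Tendsto D atTop (nhds 0))
    (hfit : ∀ k i, 3 * δ (k + 1) i ≤ 2 * ρ k i)
    (hE : ∀ k (c : ι → ℝ), ∃ p : ι → ℝ, (∀ i, c i ≤ p i ∧ p i ≤ c i + δ k i) ∧
      {w : ι → ℝ | ∀ i, |w i - p i| ≤ ρ k i} ⊆ E k)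
    (hG : ∀ k r, 0 < r → r ≤ D (k + 1) → (∏ i, 81 / ρ k i) *
      ∏ i, (max (δ (k + 1) i) r * min 1 (r / ρ (k + 1) i)) ≤ r ^ s) :
    μH[s] {w : ι → ℝ | ∀ k, w ∈ E (k + 1)} ≠ 0 := by
  classical
  choose pick hpick hpickE using hE
  have hδ : ∀ k i, 0 < δ k i := fun k i => (hρ k i).trans_le (hρδ k i)
  have hD0 : ∀ k, 0 < D k := fun k => (hδ k (Classical.arbitrary ι)).trans_le (hδD k _)
  set I : ℕ → Finset (ι → ℕ) := fun k =>
    Fintype.piFinset fun i => Finset.range ⌊2 * ρ k i / (3 * δ (k + 1) i)⌋₊ with hIdef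
  set ch : ℕ → (ι → ℝ) → (ι → ℕ) → ι → ℝ := fun k p d =>
    pick (k + 1) fun i => p i - ρ k i + δ (k + 1) i + 3 * δ (k + 1) i * d i with hch
  set B : ℕ → (ι → ℝ) → Set (ι → ℝ) := fun k p => {w | ∀ i, |w i - p i| ≤ ρ k i} with hBdef
  have hI : ∀ k, (I k).Nonempty := by
    refine fun k => ⟨fun _ => 0, Fintype.mem_piFinset.2 fun i => Finset.mem_range.2 ?_⟩
    have := hδ (k + 1) i
    exact Nat.floor_pos.2 ((one_le_div (by positivity)).2 (hfit k i))
  have hne : ∀ k p, (B k p).Nonempty := fun k p => ⟨p, fun i => by simpa using (hρ k i).le⟩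
  have hcpt : ∀ k p, IsCompact (B k p) := by
    intro k p
    have : B k p = Set.Icc (fun i => p i - ρ k i) fun i => p i + ρ k i := by
      ext w
      simp only [hBdef, Set.mem_ofPred_eq, Set.mem_Icc, Pi.le_def, abs_le, ← forall_and]
      refine forall_congr' fun i => ?_
      constructor <;> rintro ⟨h1, h2⟩ <;> constructor <;> linarith
    rw [this]
    exact isCompact_Icc
  have hB : ∀ k p, ∀ d ∈ I k, B (k + 1) (ch k p d) ⊆ B k p := by
    intro k p d hd w hw i
    have h1 := hw i
    have h2 := hpick (k + 1) (fun i => p i - ρ k i + δ (k + 1) i + 3 * δ (k + 1) i * d i) i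
    have h3 := hρδ (k + 1) i
    have h4 := hδ (k + 1) i
    have h5 : (d i : ℝ) + 1 ≤ 2 * ρ k i / (3 * δ (k + 1) i) := by
      refine le_trans ?_ (Nat.floor_le (div_nonneg (by linarith [hρ k i]) (by positivity)))
      exact_mod_cast Finset.mem_range.1 (Fintype.mem_piFinset.1 hd i)
    rw [le_div_iff₀ (by positivity)] at h5
    have h6 : 0 ≤ 3 * δ (k + 1) i * d i := by positivity
    change |w i - pick (k + 1) _ i| ≤ _ at h1
    rw [abs_le] at h1 ⊢
    constructor <;> linarith
  have hfrac : ∀ (U : Set (ι → ℝ)) (r b : ℝ) (j k : ℕ), 0 < r →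
      Metric.ediam U ≤ ENNReal.ofReal r → 0 ≤ b →
      (∀ q, meetFraction I ch B U j (k + 1) q ≤ b) → ∀ p, meetFraction I ch B U (j + 1) k p ≤
        (∏ i, min 1 (9 * max (δ (k + 1) i) r / ρ k i)) * b := by
    intro U r b j k hr hU hb h p
    exact meetFraction_succ_le_mul hI hB hb h
      (card_filter_box_meet_le (p := fun i => p i - ρ k i + δ (k + 1) i) hr hU (hρ k) (hδ (k + 1))
        (hρδ (k + 1)) (hfit k) (ch k p) fun d i =>
          hpick (k + 1) (fun i => p i - ρ k i + δ (k + 1) i + 3 * δ (k + 1) i * d i) i)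
  have hfrac0 : ∀ k r, 0 < r → 0 ≤ ∏ i, min 1 (9 * max (δ (k + 1) i) r / ρ k i) := by
    intro k r hr
    refine Finset.prod_nonneg fun i _ => ?_
    have := hρ k i
    positivity
  have hmass : ∀ (U : Set (ι → ℝ)) (r : ℝ), 0 < r → r ≤ D 1 →
      Metric.ediam U ≤ ENNReal.ofReal r →
      ∃ J, ∀ j, J ≤ j → meetFraction I ch B U j 0 0 ≤ r ^ s := by
    intro U r hr hr1 hU
    have hex : ∃ j, D (j + 2) < r :=
      ((tendsto_add_atTop_iff_nat 2).2 hD |>.eventually_lt_const hr).exists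
    obtain ⟨j, hj, hjr⟩ : ∃ j, D (j + 2) < r ∧ r ≤ D (j + 1) := by
      refine ⟨Nat.find hex, Nat.find_spec hex, ?_⟩
      rcases Nat.eq_zero_or_pos (Nat.find hex) with h0 | h0
      · rw [h0]; exact hr1
      · have := Nat.find_min hex (Nat.sub_lt h0 one_pos)
        rw [not_lt, show Nat.find hex - 1 + 2 = Nat.find hex + 1 by omega] at this
        exact this
    refine ⟨j + 2, fun J hJ => ?_⟩
    obtain ⟨J', rfl⟩ := Nat.exists_eq_add_of_le hJ
    rw [show j + 2 + J' = J' + 1 + 1 + j by omega]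
    refine (meetFraction_add_le hI (hfrac U r _ _ j hr hU (mul_nonneg (hfrac0 _ r hr) zero_le_one)
      (hfrac U r 1 J' (j + 1) hr hU zero_le_one fun q => meetFraction_le_one hI _ _ _)) 0).trans ?_
    refine le_trans ?_ (hG j r hr hjr)
    rw [mul_one, ← Finset.prod_mul_distrib, ← Finset.prod_mul_distrib]
    refine Finset.prod_le_prod (fun i _ => ?_) fun i _ => ?_
    · have := hρ j i
      have := hρ (j + 1) i
      positivity
    · have h1 := hρ j i
      have h2 := hρ (j + 1) i
      rw [max_eq_right ((hδD (j + 1 + 1) i).trans hj.le)]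
      have h3 : min 1 (9 * r / ρ (j + 1) i) ≤ 9 * min 1 (r / ρ (j + 1) i) := by
        rw [mul_min_of_nonneg _ _ (by norm_num : (0 : ℝ) ≤ 9), mul_div_assoc]
        exact min_le_min (by norm_num) le_rfl
      calc _ ≤ 9 * max (δ (j + 1) i) r / ρ j i * (9 * min 1 (r / ρ (j + 1) i)) := by
            gcongr
            exact min_le_right _ _
        _ = _ := by ring
  have hmain := one_le_hausdorffMeasure_iInter_treeLevel hI hne hcpt hB 0 hs (hD0 1) hmass
  refine fun h0 => ?_
  have hsub : (⋂ j, treeLevel I ch B j 0 0) ⊆ {w : ι → ℝ | ∀ k, w ∈ E (k + 1)} := by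
    intro w hw k
    have := treeLevel_subset (E := E) (fun k p d _ => hpickE (k + 1) _) k 0 0
      (Set.mem_iInter.1 hw (k + 1))
    rwa [zero_add] at this
  have := hmain.trans ((measure_mono hsub).trans h0.le)
  simp at this

theorem le_dimH_frequently_mem_of_box_subset [Nonempty ι] (E : ℕ → Set (ι → ℝ))
    (δ ρ : ℕ → ι → ℝ) (D : ℕ → ℝ) {s : NNReal} (hs : 0 < s) (hρ : ∀ n i, 0 < ρ n i)
    (hρδ : ∀ n i, ρ n i ≤ δ n i) (hδD : ∀ n i, δ n i ≤ D n) (hD : Tendsto D atTop (nhds 0))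
    (hE : ∀ᶠ n in atTop, ∀ c : ι → ℝ, ∃ p : ι → ℝ, (∀ i, c i ≤ p i ∧ p i ≤ c i + δ n i) ∧
      {w : ι → ℝ | ∀ i, |w i - p i| ≤ ρ n i} ⊆ E n)
    (hG : ∀ C : ℝ, ∀ᶠ n in atTop, ∀ r, 0 < r → r ≤ D n →
      C * ∏ i, (max (δ n i) r * min 1 (r / ρ n i)) ≤ r ^ (s : ℝ)) :
    s ≤ dimH {w : ι → ℝ | ∃ᶠ n in atTop, w ∈ E n} := by
  have hδ0 : ∀ i, Tendsto (fun n => δ n i) atTop (nhds 0) := fun i =>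
    squeeze_zero (fun n => (hρ n i).le.trans (hρδ n i)) (fun n => hδD n i) hD
  have hnext : ∀ n, ∀ᶠ n' in atTop, n < n' ∧ (∀ i, 3 * δ n' i ≤ 2 * ρ n i) := by
    refine fun n => (eventually_gt_atTop n).and (eventually_all.2 fun i => ?_)
    have h0 : 0 < 2 / 3 * ρ n i := by have := hρ n i; positivity
    filter_upwards [(hδ0 i).eventually_lt_const h0] with n' hn'
    linarith
  choose next hnx hnE hnG using fun n =>
    ((hnext n).and (hE.and (hG (∏ i, 81 / ρ n i)))).exists
  set φ : ℕ → ℕ := fun k => next^[k + 1] 0 with hφdef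
  have hφ : ∀ k, φ (k + 1) = next (φ k) := fun k => Function.iterate_succ_apply' _ _ _
  have hφE : ∀ k, ∃ m, φ k = next m := fun k => ⟨_, Function.iterate_succ_apply' _ _ _⟩
  have hmono : StrictMono φ := strictMono_nat_of_lt_succ fun k => by rw [hφ]; exact (hnx _).1
  refine (le_dimH_of_hausdorffMeasure_ne_zero (hausdorffMeasure_setOf_forall_mem_ne_zero
    (fun k => E (φ k)) (fun k => δ (φ k)) (fun k => ρ (φ k)) (fun k => D (φ k))
    (NNReal.coe_pos.2 hs) (fun k => hρ _) (fun k => hρδ _) (fun k => hδD _)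
    (hD.comp hmono.tendsto_atTop) (fun k => ?_) (fun k => ?_) fun k => ?_)).trans
    (dimH_mono fun w hw => ?_)
  · rw [hφ]; exact (hnx _).2
  · obtain ⟨m, hm⟩ := hφE k
    rw [hm]; exact hnE m
  · rw [hφ]; exact hnG _
  · exact frequently_atTop.2 fun N =>
      ⟨φ (N + 1), (Nat.le_succ N).trans (hmono.id_le _), hw N⟩

end Boxes

theorem mul_le_sum_min_add_sum_max {M L τ s t : ℝ} (hL : 0 < L) (hLM : L < M) (hτ : 0 < τ)
    (ht : 0 ≤ t) (h1 : s * (τ + L) ≤ τ + 3 * L) (h2 : s * (τ + M) ≤ 3 * M)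
    (h3 : s * (τ + L) ≤ 2 * L + M) (h4 : s * τ ≤ L + M) (h5 : s * τ ≤ τ + L) :
    s * t ≤ min M t + max 0 (t - (M + τ)) + (min (L - min τ (L / 2)) t + max 0 (t - (L + τ))) +
      (min (min τ (L / 2)) t + max 0 (t - τ)) := by
  have hs3 : s ≤ 3 := by
    by_contra! h
    nlinarith
  have hA : s * τ ≤ min M τ + L := by
    rcases le_total M τ with h | h <;> simp only [h, min_eq_left, min_eq_right] <;> linarith
  have hB : s * (τ + L) ≤ min M (τ + L) + 2 * L := by
    rcases le_total M (τ + L) with h | h <;> simp only [h, min_eq_left, min_eq_right] <;> linarith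
  have interp : ∀ {x y : ℝ}, x < y → x ≤ t → t ≤ y →
      (y - t) * min M x + (t - x) * min M y ≤ (y - x) * min M t := by
    intro x y hxy hx hy
    rw [mul_min_of_nonneg _ _ (by linarith : 0 ≤ y - x)]
    refine le_min ?_ ?_
    · nlinarith [min_le_left M x, min_le_left M y]
    · nlinarith [min_le_right M x, min_le_right M y]
  set σ := min τ (L / 2) with hσ
  have hστ : σ ≤ τ := min_le_left _ _
  have hσL : σ ≤ L / 2 := min_le_right _ _
  rcases le_total t (L - σ) with hc | hc
  · have hmid : 2 * t ≤ min σ t + t + max 0 (t - τ) := by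
      rcases le_total t σ with h | h
      · rw [min_eq_right h]; linarith [le_max_left 0 (t - τ)]
      · rw [min_eq_left h]
        rcases min_choice τ (L / 2) with h' | h'
        · rw [← hσ] at h'; linarith [le_max_right 0 (t - τ)]
        · rw [← hσ] at h'; linarith [le_max_left 0 (t - τ)]
    have hσ0 : 0 < σ := lt_min hτ (by positivity)
    rw [min_eq_right hc, min_eq_right (by linarith : t ≤ M)]
    nlinarith [le_max_left 0 (t - (M + τ)), le_max_left 0 (t - (L + τ))]
  · rw [min_eq_left hc, min_eq_left (by linarith : σ ≤ t)]
    have m1 := le_max_left 0 (t - (M + τ))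
    have m2 := le_max_left 0 (t - (L + τ))
    have m3 := le_max_left 0 (t - τ)
    have m1' := le_max_right 0 (t - (M + τ))
    have m2' := le_max_right 0 (t - (L + τ))
    have m3' := le_max_right 0 (t - τ)
    suffices h : s * t ≤ min M t + L + max 0 (t - (M + τ)) + max 0 (t - (L + τ)) + max 0 (t - τ) by
      linarith
    rcases le_total t τ with c1 | c1
    · suffices h : s * t ≤ min M t + L by linarith
      have : τ * (s * t) ≤ τ * (min M t + L) := by
        rw [← min_add_add_right, mul_min_of_nonneg _ _ hτ.le]
        refine le_min ?_ ?_ <;> nlinarith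
      exact le_of_mul_le_mul_left this hτ
    rcases le_total t (τ + L) with c2 | c2
    · suffices h : s * t ≤ min M t + L + (t - τ) by linarith
      have h := interp (by linarith : τ < τ + L) c1 c2
      have : L * (s * t) ≤ L * (min M t + L + (t - τ)) := by
        nlinarith [mul_le_mul_of_nonneg_left hA (by linarith : 0 ≤ τ + L - t),
          mul_le_mul_of_nonneg_left hB (by linarith : 0 ≤ t - τ)]
      exact le_of_mul_le_mul_left this hL
    rcases le_total t (τ + M) with c3 | c3
    · suffices h : s * t ≤ min M t + 2 * t - 2 * τ by linarith
      have h := interp (by linarith : τ + L < τ + M) c2 c3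
      rw [min_eq_left (by linarith : M ≤ τ + M)] at h
      have : (M - L) * (s * t) ≤ (M - L) * (min M t + 2 * t - 2 * τ) := by
        nlinarith [mul_le_mul_of_nonneg_left hB (by linarith : 0 ≤ τ + M - t),
          mul_le_mul_of_nonneg_left h2 (by linarith : 0 ≤ t - (τ + L))]
      exact le_of_mul_le_mul_left this (by linarith)
    · rw [min_eq_left (by linarith : M ≤ t)]
      nlinarith

theorem eventually_mul_prod_max_mul_min_le {ι : Type*} [Fintype ι] (d e : ι → ℝ)
    {K κ σ s s' : ℝ} (hK : 1 ≤ K) (hκ : 0 < κ) (hκ1 : κ ≤ 1) (hσ : 0 < σ) (hs : s < s')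
    (h : ∀ t, 0 ≤ t → s' * t ≤ ∑ i, (min (d i) t + max 0 (t - e i))) (C : ℝ) :
    ∀ᶠ n : ℕ in atTop, ∀ r, 0 < r → r ≤ K * Real.exp (-n * σ) →
      C * ∏ i, (max (K * Real.exp (-n * d i)) r * min 1 (r / (κ * Real.exp (-n * e i)))) ≤
        r ^ s := by
  have hlin : Tendsto (fun n : ℕ => (n : ℝ) * σ - Real.log K) atTop atTop :=
    tendsto_atTop_add_const_right _ _ (tendsto_natCast_atTop_atTop.atTop_mul_const hσ)
  have hexp : Tendsto (fun n : ℕ => Real.exp ((s' - s) * ((n : ℝ) * σ - Real.log K))) atTop atTop :=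
    Real.tendsto_exp_atTop.comp (hlin.const_mul_atTop (sub_pos.2 hs))
  filter_upwards [hlin.eventually_ge_atTop 0, eventually_gt_atTop 0,
    hexp.eventually_ge_atTop (|C| * ∏ _i : ι, (K * κ⁻¹))] with n hn0 hn hnC r hr hrK
  have hnR : (0 : ℝ) < n := by exact_mod_cast hn
  have hK0 : 0 < K := by linarith
  obtain ⟨t, ht⟩ : ∃ t, r = Real.exp (-n * t) :=
    ⟨-Real.log r / n, by rw [neg_mul, mul_div_cancel₀ _ hnR.ne', neg_neg, Real.exp_log hr]⟩
  have hnt : n * σ - Real.log K ≤ n * t := by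
    have := Real.log_le_log hr hrK
    rw [Real.log_mul hK0.ne' (Real.exp_pos _).ne', Real.log_exp, ht, Real.log_exp] at this
    linarith
  have ht0 : 0 ≤ t := by
    by_contra! h'
    nlinarith
  have hfac : ∀ i, max (K * Real.exp (-n * d i)) r * min 1 (r / (κ * Real.exp (-n * e i)))
      ≤ K * κ⁻¹ * Real.exp (-n * (min (d i) t + max 0 (t - e i))) := by
    intro i
    have a1 : max (K * Real.exp (-n * d i)) r ≤ K * Real.exp (-n * min (d i) t) := by
      refine max_le ?_ ?_
      · gcongr K * Real.exp ?_
        nlinarith [min_le_left (d i) t]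
      · rw [ht]
        calc Real.exp (-n * t) ≤ Real.exp (-n * min (d i) t) := by
              gcongr Real.exp ?_
              nlinarith [min_le_right (d i) t]
          _ ≤ K * Real.exp (-n * min (d i) t) := le_mul_of_one_le_left (Real.exp_pos _).le hK
    have a2 : min 1 (r / (κ * Real.exp (-n * e i))) ≤ κ⁻¹ * Real.exp (-n * max 0 (t - e i)) := by
      rcases le_total 0 (t - e i) with h' | h'
      · rw [max_eq_right h']
        refine (min_le_right _ _).trans (le_of_eq ?_)
        rw [ht, mul_comm κ, ← div_div, ← Real.exp_sub, div_eq_inv_mul]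
        ring_nf
      · rw [max_eq_left h', mul_zero, Real.exp_zero, mul_one]
        exact (min_le_left _ _).trans ((one_le_inv₀ hκ).2 hκ1)
    calc _ ≤ K * Real.exp (-n * min (d i) t) * (κ⁻¹ * Real.exp (-n * max 0 (t - e i))) := by
          gcongr
      _ = _ := by rw [mul_add, Real.exp_add]; ring
  have hfac0 : ∀ i, 0 ≤ max (K * Real.exp (-n * d i)) r * min 1 (r / (κ * Real.exp (-n * e i))) :=
    fun i => by positivity
  calc C * ∏ i, (max (K * Real.exp (-n * d i)) r * min 1 (r / (κ * Real.exp (-n * e i))))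
      ≤ |C| * ∏ i, (K * κ⁻¹ * Real.exp (-n * (min (d i) t + max 0 (t - e i)))) :=
        mul_le_mul (le_abs_self C) (Finset.prod_le_prod (fun i _ => hfac0 i) fun i _ => hfac i)
          (Finset.prod_nonneg fun i _ => hfac0 i) (abs_nonneg C)
    _ = |C| * (∏ _i : ι, (K * κ⁻¹)) *
        Real.exp (-n * ∑ i, (min (d i) t + max 0 (t - e i))) := by
        rw [Finset.prod_mul_distrib, ← Real.exp_sum, Finset.mul_sum, mul_assoc]
    _ ≤ Real.exp ((s' - s) * (n * t)) * Real.exp (-n * (s' * t)) := by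
        have b1 := h t ht0
        have b2 : Real.exp ((s' - s) * (n * σ - Real.log K)) ≤ Real.exp ((s' - s) * (n * t)) :=
          Real.exp_le_exp.2 (mul_le_mul_of_nonneg_left hnt (sub_pos.2 hs).le)
        refine mul_le_mul (hnC.trans b2) (Real.exp_le_exp.2 ?_) (Real.exp_pos _).le
          (Real.exp_pos _).le
        nlinarith
    _ = r ^ s := by
        rw [ht, ← Real.exp_mul, ← Real.exp_add]
        congr 1
        ring

/-- The recurrence set of the linear map with left eigenvectors the rows of `P` and eigenvalues `D`,
in eigencoordinates. -/
def eigenRecSet (P : Matrix (Fin 3) (Fin 3) ℝ) (D : Fin 3 → ℝ) (τ C : ℝ) : Set (Fin 3 → ℝ) :=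
  {w | ∃ᶠ n : ℕ in atTop, ∃ z : Fin 3 → ℤ,
    ∀ i, |(D i ^ n - 1) * w i - P.mulVec (fun j => (z j : ℝ)) i| < C * Real.exp (-n * τ)}

theorem exists_dimH_eigenRecSet_le_and_le {A : Matrix (Fin 3) (Fin 3) ℤ}
    {P : Matrix (Fin 3) (Fin 3) ℝ} {D : Fin 3 → ℝ} (τ : ℝ) (hP : P.det ≠ 0)
    (hAP : P * A.map (Int.cast : ℤ → ℝ) = Matrix.diagonal D * P) :
    (∃ C > 0, dimH (eigenRecSet P D τ C) ≤ dimH (recSet3 A τ)) ∧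
      ∃ C > 0, dimH (recSet3 A τ) ≤ dimH (eigenRecSet P D τ C) := by
  have hinv : Invertible P := P.invertibleOfIsUnitDet (isUnit_iff_ne_zero.2 hP)
  set Φ : EuclideanSpace ℝ (Fin 3) ≃L[ℝ] (Fin 3 → ℝ) :=
    (EuclideanSpace.equiv (Fin 3) ℝ).trans (P.toLinearEquiv' hinv).toContinuousLinearEquiv with hΦ
  have hΦx : ∀ x, Φ x = P.mulVec x.ofLp := fun x => rfl
  have hpow : ∀ n : ℕ, P * (A ^ n).map (Int.cast : ℤ → ℝ) = Matrix.diagonal (D ^ n) * P := by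
    intro n
    have h1 : (A ^ n).map (Int.cast : ℤ → ℝ) = (A.map (Int.cast : ℤ → ℝ)) ^ n :=
      map_pow (Int.castRingHom ℝ).mapMatrix A n
    rw [h1, ← Matrix.diagonal_pow]
    exact (SemiconjBy.pow_right (show SemiconjBy P _ _ from hAP) n)
  have hkey : ∀ (n : ℕ) (x : EuclideanSpace ℝ (Fin 3)) (z : Fin 3 → ℤ) (i : Fin 3),
      Φ (Matrix.toEuclideanLin ((A ^ n).map (Int.cast : ℤ → ℝ)) x - x - intVec3 z) i =
        (D i ^ n - 1) * Φ x i - P.mulVec (fun j => (z j : ℝ)) i := by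
    intro n x z i
    have e1 : Φ (Matrix.toEuclideanLin ((A ^ n).map (Int.cast : ℤ → ℝ)) x) i = D i ^ n * Φ x i := by
      rw [hΦx, hΦx]
      change (P.mulVec (((A ^ n).map (Int.cast : ℤ → ℝ)).mulVec x.ofLp)) i = _
      rw [Matrix.mulVec_mulVec, hpow, ← Matrix.mulVec_mulVec, Matrix.mulVec_diagonal, Pi.pow_apply]
    have e2 : Φ (intVec3 z) i = P.mulVec (fun j => (z j : ℝ)) i := rfl
    rw [map_sub, map_sub, Pi.sub_apply, Pi.sub_apply, e1, e2]
    ring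
  have hd : dimH (recSet3 A τ) = dimH (Φ '' recSet3 A τ) := (Φ.dimH_image _).symm
  rw [hd]
  constructor
  · obtain ⟨K, hK, hb⟩ := Φ.symm.toContinuousLinearMap.bound
    refine ⟨1 / K, by positivity, dimH_mono fun w hw => ⟨Φ.symm w, ?_, Φ.apply_symm_apply w⟩⟩
    refine hw.mono ?_
    rintro n ⟨z, hz⟩
    refine ⟨z, ?_⟩
    set v := Matrix.toEuclideanLin ((A ^ n).map (Int.cast : ℤ → ℝ)) (Φ.symm w) - Φ.symm w - intVec3 z
      with hv
    have h1 : ‖Φ v‖ < 1 / K * Real.exp (-n * τ) := by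
      refine (pi_norm_lt_iff (by positivity)).2 fun i => ?_
      rw [hv, hkey, Φ.apply_symm_apply]
      exact hz i
    have h2 := hb (Φ v)
    simp only [ContinuousLinearEquiv.coe_coe, ContinuousLinearEquiv.symm_apply_apply] at h2
    calc ‖v‖ ≤ K * ‖Φ v‖ := h2
      _ < K * (1 / K * Real.exp (-n * τ)) := by gcongr
      _ = _ := by field_simp
  · obtain ⟨K, hK, hb⟩ := Φ.toContinuousLinearMap.bound
    refine ⟨K, hK, dimH_mono ?_⟩
    rintro _ ⟨x, hx, rfl⟩
    refine hx.mono ?_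
    rintro n ⟨z, hz⟩
    refine ⟨z, fun i => ?_⟩
    rw [← hkey]
    refine (norm_le_pi_norm _ i).trans_lt ((hb _).trans_lt ?_)
    gcongr

theorem dimH_frequently_mem_le_of_boxes {ι : Type*} [Fintype ι] (A : ℕ → Set (ι → ℝ)) (e : ι → ℝ)
    {C K g t : ℝ} (hC : 0 ≤ C) (hK : 0 ≤ K) (ht : 0 < t)
    (hA : ∀ᶠ n : ℕ in atTop, ∃ I : Finset (ι → ℝ), (I.card : ℝ) ≤ C * Real.exp (n * g) ∧
      A n ⊆ ⋃ p ∈ I, {w | ∀ i, |w i - p i| ≤ K * Real.exp (-n * e i)}) :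
    dimH {w | ∃ᶠ n in atTop, w ∈ A n} ≤ ENNReal.ofReal ((g + ∑ i, max 0 (t - e i)) / t) := by
  refine dimH_frequently_mem_le A (C := C * (K + 1) ^ Fintype.card ι) (by positivity) ht ?_
  filter_upwards [hA] with n ⟨I, hI, hAI⟩
  have hN : ∏ i, (|K * Real.exp (-n * e i)| / Real.exp (-n * t) + 1) ≤
      (K + 1) ^ Fintype.card ι * Real.exp (n * ∑ i, max 0 (t - e i)) := by
    have : (K + 1) ^ Fintype.card ι * Real.exp (n * ∑ i, max 0 (t - e i)) =
        ∏ i, ((K + 1) * Real.exp (n * max 0 (t - e i))) := by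
      rw [Finset.prod_mul_distrib, ← Real.exp_sum, Finset.mul_sum]
      simp
    rw [this]
    refine Finset.prod_le_prod (fun i _ => by positivity) fun i _ => ?_
    rw [abs_of_nonneg (by positivity), mul_div_assoc, ← Real.exp_sub, add_one_mul]
    have h1 : -(n : ℝ) * e i - -n * t ≤ n * max 0 (t - e i) := by
      have := mul_le_mul_of_nonneg_left (le_max_right 0 (t - e i)) n.cast_nonneg (α := ℝ)
      linarith
    have h2 : 1 ≤ Real.exp (n * max 0 (t - e i)) := Real.one_le_exp (by positivity)
    gcongr
  have := IsCoveredBy.of_subset_biUnion I _ hI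
    (Finset.prod_nonneg fun i _ => by positivity)
    (fun p _ => isCoveredBy_box p (fun i => K * Real.exp (-n * e i)) (Real.exp_pos (-n * t))) hAI
  obtain ⟨F, hF, hAF⟩ := this
  refine ⟨F, hF.trans ((mul_le_mul_of_nonneg_left hN (by positivity)).trans_eq ?_), hAF⟩
  rw [mul_add, Real.exp_add]
  ring

theorem exists_finset_int_prod {α β β' V : ℝ} (hα : α ≠ 0) (hβ : β ≠ β') (hV : 0 ≤ V) :
    ∃ C, 0 ≤ C ∧ ∀ X : ℝ, 1 ≤ X → ∃ F : Finset (ℤ × ℤ), (F.card : ℝ) ≤ C * X ∧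
      ∀ x y : ℤ, |α * x + β * y| ≤ V * X → |α * x + β' * y| ≤ V → (x, y) ∈ F := by
  have hα' : 0 < |α| := abs_pos.2 hα
  have hβ' : 0 < |β - β'| := abs_pos.2 (sub_ne_zero.2 hβ)
  refine ⟨(4 * V / |β - β'| + 1) * (2 * V / |α| + 1), by positivity, fun X hX => ?_⟩
  set Y : ℝ := 2 * V * X / |β - β'| with hY
  have hY0 : 0 ≤ Y := by positivity
  set S : Finset ℤ := Finset.Icc ⌈-Y⌉ ⌊Y⌋
  set R : ℤ → Finset ℤ := fun y =>
    Finset.Icc ⌈-(β' * y / α) - V / |α|⌉ ⌊-(β' * y / α) + V / |α|⌋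
  refine ⟨(S.sigma R).image fun q => (q.2, q.1), ?_, fun x y h1 h2 => ?_⟩
  · have hS : (S.card : ℝ) ≤ Y - -Y + 1 := Int.card_le_of_forall_mem_le (by linarith) fun z hz => by
      rw [Finset.mem_Icc, Int.ceil_le, Int.le_floor] at hz
      exact hz
    have hR : ∀ y, ((R y).card : ℝ) ≤ 2 * V / |α| + 1 := fun y => by
      have hVα : 0 ≤ V / |α| := by positivity
      refine (Int.card_le_of_forall_mem_le (a := -(β' * y / α) - V / |α|)
        (b := -(β' * y / α) + V / |α|) (by linarith) fun z hz => ?_).trans_eq (by ring)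
      rw [Finset.mem_Icc, Int.ceil_le, Int.le_floor] at hz
      exact hz
    calc (((S.sigma R).image fun q => (q.2, q.1)).card : ℝ) ≤ ((S.sigma R).card : ℝ) :=
          Nat.cast_le.2 Finset.card_image_le
      _ = ∑ y ∈ S, ((R y).card : ℝ) := by rw [Finset.card_sigma]; push_cast; rfl
      _ ≤ S.card * (2 * V / |α| + 1) := by
          rw [← nsmul_eq_mul]
          exact Finset.sum_le_card_nsmul _ _ _ fun y _ => hR y
      _ ≤ ((4 * V / |β - β'| + 1) * X) * (2 * V / |α| + 1) := by
          gcongr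
          refine hS.trans ?_
          rw [add_mul, one_mul]
          refine add_le_add (le_of_eq ?_) hX
          rw [hY]; ring
      _ = _ := by ring
  · rw [Finset.mem_image]
    refine ⟨⟨y, x⟩, ?_, rfl⟩
    rw [Finset.mem_sigma, Finset.mem_Icc, Finset.mem_Icc, Int.ceil_le, Int.le_floor, Int.ceil_le,
      Int.le_floor]
    have hy : |(y : ℝ)| ≤ Y := by
      rw [hY, le_div_iff₀ hβ', ← abs_mul]
      calc |y * (β - β')| = |(α * x + β * y) - (α * x + β' * y)| := by congr 1; ring
        _ ≤ |α * x + β * y| + |α * x + β' * y| := abs_sub _ _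
        _ ≤ V * X + V * 1 := by linarith
        _ ≤ 2 * V * X := by nlinarith
    have hx : |(x : ℝ) + β' * y / α| ≤ V / |α| := by
      rw [le_div_iff₀ hα', ← abs_mul]
      rwa [show ((x : ℝ) + β' * y / α) * α = α * x + β' * y by field_simp]
    rw [abs_le] at hy hx
    exact ⟨hy, by linarith, by linarith⟩

/-- The rows are left eigenvectors of `[[m,0,0],[0,a,b],[0,c,d]]`. -/
noncomputable def eigenMatrix (a c : ℤ) (l : ℝ) : Matrix (Fin 3) (Fin 3) ℝ :=
  !![1, 0, 0; 0, c, l - a; 0, c, l⁻¹ - a]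

theorem eigenMatrix_mulVec (a c : ℤ) (l : ℝ) (v : Fin 3 → ℝ) :
    (eigenMatrix a c l).mulVec v =
      ![v 0, c * v 1 + (l - a) * v 2, c * v 1 + (l⁻¹ - a) * v 2] := by
  ext i
  fin_cases i <;> simp [eigenMatrix, Matrix.mulVec, dotProduct, Fin.sum_univ_three]

theorem eigenvalue_pow_sub_one_bounds {m : ℤ} {l : ℝ} (hl : 1 < l) (hml : l < m) {n : ℕ}
    (hn : 1 ≤ n) (i : Fin 3) :
    (1 - l⁻¹) * Real.exp (n * (![Real.log m, Real.log l, 0] : Fin 3 → ℝ) i) ≤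
        |(![(m : ℝ), l, l⁻¹] : Fin 3 → ℝ) i ^ n - 1| ∧
      |(![(m : ℝ), l, l⁻¹] : Fin 3 → ℝ) i ^ n - 1| ≤
        Real.exp (n * (![Real.log m, Real.log l, 0] : Fin 3 → ℝ) i) := by
  have hl0 : 0 < l := by linarith
  have hli : l⁻¹ < 1 := inv_lt_one_of_one_lt₀ hl
  have hli0 : 0 < l⁻¹ := inv_pos.2 hl0
  have hbig : ∀ x : ℝ, l ≤ x → (1 - l⁻¹) * Real.exp (n * Real.log x) ≤ |x ^ n - 1| ∧
      |x ^ n - 1| ≤ Real.exp (n * Real.log x) := by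
    intro x hx
    have hx0 : 0 < x := by linarith
    have h1 : l ≤ x ^ n := hx.trans (le_self_pow₀ (by linarith) (by omega))
    rw [← Real.log_pow, Real.exp_log (by positivity), abs_of_nonneg (by linarith)]
    have h2 : 1 ≤ l⁻¹ * x ^ n := by
      rw [← inv_mul_cancel₀ hl0.ne']; gcongr
    constructor <;> linarith
  fin_cases i
  · exact hbig m hml.le
  · exact hbig l le_rfl
  · have h1 : l⁻¹ ^ n ≤ l⁻¹ := pow_le_of_le_one hli0.le hli.le (by omega)
    have h2 : 0 < l⁻¹ ^ n := by positivity
    simp only [Fin.reduceFinMk, Matrix.cons_val, mul_zero, Real.exp_zero, mul_one]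
    rw [abs_of_nonpos (by linarith)]
    constructor <;> linarith

section EigenRecSet

variable {m a c : ℤ} {l τ C : ℝ}

theorem abs_le_of_abs_eigen_lt (hl : 1 < l) (hml : l < m) (hτ : 0 < τ) (hC : 0 < C) {n : ℕ}
    (hn : 1 ≤ n) {i : Fin 3} {x γ W : ℝ} (hx : |x| ≤ W)
    (h : |((![(m : ℝ), l, l⁻¹] : Fin 3 → ℝ) i ^ n - 1) * x - γ| < C * Real.exp (-n * τ)) :
    |γ| ≤ (W + C) * Real.exp (n * (![Real.log m, Real.log l, 0] : Fin 3 → ℝ) i) ∧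
      |x - γ / ((![(m : ℝ), l, l⁻¹] : Fin 3 → ℝ) i ^ n - 1)| ≤
        C / (1 - l⁻¹) *
          Real.exp (-n * ((![Real.log m, Real.log l, 0] : Fin 3 → ℝ) i + τ)) := by
  obtain ⟨h1, h2⟩ := eigenvalue_pow_sub_one_bounds hl hml hn i
  set E := (![Real.log m, Real.log l, 0] : Fin 3 → ℝ) i with hE
  set y := (![(m : ℝ), l, l⁻¹] : Fin 3 → ℝ) i ^ n - 1
  have hli : 0 < 1 - l⁻¹ := sub_pos.2 (inv_lt_one_of_one_lt₀ hl)
  have hy : 0 < |y| := lt_of_lt_of_le (by positivity) h1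
  have hE0 : 0 ≤ E := by
    have := Real.log_pos hl
    have := Real.log_pos (hl.trans hml)
    fin_cases i <;> simp [hE] <;> linarith
  constructor
  · have h3 : Real.exp (-n * τ) ≤ Real.exp (n * E) :=
      Real.exp_le_exp.2 (by have : 0 ≤ n * E := by positivity
                            have : 0 ≤ n * τ := by positivity
                            linarith)
    calc |γ| = |y * x - (y * x - γ)| := by congr 1; ring
      _ ≤ |y * x| + |y * x - γ| := abs_sub _ _
      _ ≤ Real.exp (n * E) * W + C * Real.exp (n * E) := by
          rw [abs_mul]
          refine add_le_add (by gcongr) (h.le.trans (by gcongr))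
      _ = _ := by ring
  · have h4 : x - γ / y = (y * x - γ) / y := by
      have := abs_pos.1 hy
      field_simp
    rw [h4, abs_div, div_le_iff₀ hy]
    refine h.le.trans ?_
    calc C * Real.exp (-n * τ) =
        C / (1 - l⁻¹) * Real.exp (-n * (E + τ)) * ((1 - l⁻¹) * Real.exp (n * E)) := by
          rw [show -(n : ℝ) * τ = -n * (E + τ) + n * E by ring, Real.exp_add]
          rw [div_mul_eq_mul_div, div_mul_eq_mul_div, eq_div_iff hli.ne']
          ring
      _ ≤ _ := by gcongr

theorem dimH_eigenRecSet_le_of_window {D : Fin 3 → ℝ} {P : Matrix (Fin 3) (Fin 3) ℝ} {x : ENNReal}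
    (h : ∀ W : ℕ, dimH {w : Fin 3 → ℝ | ∃ᶠ n : ℕ in atTop, w ∈ {w : Fin 3 → ℝ | (∀ i, |w i| ≤ W) ∧
      ∃ z : Fin 3 → ℤ, ∀ i, |(D i ^ n - 1) * w i - P.mulVec (fun j => (z j : ℝ)) i| <
        C * Real.exp (-n * τ)}} ≤ x) :
    dimH (eigenRecSet P D τ C) ≤ x := by
  refine (dimH_mono fun w hw => ?_).trans ((dimH_iUnion _).trans_le (iSup_le h))
  obtain ⟨W, hW⟩ := exists_nat_ge ‖w‖
  exact Set.mem_iUnion.2 ⟨W, hw.mono fun n hz => ⟨fun i => (norm_le_pi_norm w i).trans hW, hz⟩⟩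

theorem dimH_eigenRecSet_le (hc : c ≠ 0) (hl : 1 < l) (hml : l < m) (hτ : 0 < τ) (hC : 0 < C)
    {t : ℝ} (ht : 0 < t) :
    dimH (eigenRecSet (eigenMatrix a c l) ![m, l, l⁻¹] τ C) ≤
      ENNReal.ofReal ((Real.log m + Real.log l +
        ∑ i, max 0 (t - (![Real.log m, Real.log l, 0] i + τ))) / t) := by
  refine dimH_eigenRecSet_le_of_window fun W => ?_
  have hli : l⁻¹ < 1 := inv_lt_one_of_one_lt₀ hl
  have hli0 : 0 < 1 - l⁻¹ := sub_pos.2 hli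
  have hlog := Real.log_pos hl
  have hlogm := Real.log_pos (hl.trans hml)
  set V : ℝ := W + C with hV
  have hV0 : 0 ≤ V := by positivity
  obtain ⟨C', hC', hF⟩ := exists_finset_int_prod (α := c) (β := l - a) (β' := l⁻¹ - a) (V := V)
    (Int.cast_ne_zero.2 hc) (by linarith) hV0
  refine dimH_frequently_mem_le_of_boxes _ _ (C := (2 * V + 1) * C') (K := C / (1 - l⁻¹))
    (by positivity) (by positivity) ht ?_
  filter_upwards [eventually_ge_atTop 1] with n hn
  obtain ⟨F, hFc, hF⟩ := hF (Real.exp (n * Real.log l)) (Real.one_le_exp (by positivity))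
  set Y : ℝ := V * Real.exp (n * Real.log m) with hY
  have hY0 : 0 ≤ Y := by positivity
  refine ⟨((Finset.Icc ⌈-Y⌉ ⌊Y⌋) ×ˢ F).image fun q i =>
    (eigenMatrix a c l).mulVec ![(q.1 : ℝ), q.2.1, q.2.2] i / (![(m : ℝ), l, l⁻¹] i ^ n - 1),
    ?_, ?_⟩
  · refine (Nat.cast_le.2 Finset.card_image_le).trans ?_
    rw [Finset.card_product, Nat.cast_mul, mul_add (n : ℝ), Real.exp_add]
    have h1 : (((Finset.Icc ⌈-Y⌉ ⌊Y⌋).card : ℕ) : ℝ) ≤ (2 * V + 1) * Real.exp (n * Real.log m) := by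
      refine (Int.card_le_of_forall_mem_le (a := -Y) (b := Y) (by linarith) fun z hz => ?_).trans ?_
      · rwa [Finset.mem_Icc, Int.ceil_le, Int.le_floor] at hz
      · have := Real.one_le_exp (by positivity : 0 ≤ n * Real.log m)
        linarith
    calc _ ≤ (2 * V + 1) * Real.exp (n * Real.log m) * (C' * Real.exp (n * Real.log l)) := by gcongr
      _ = _ := by ring
  · rintro w ⟨hw, z, hz⟩
    have hb := fun i => abs_le_of_abs_eigen_lt hl hml hτ hC hn (hw i) (hz i)
    have hz' : (fun j => (z j : ℝ)) = ![(z 0 : ℝ), z 1, z 2] := by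
      ext j; fin_cases j <;> rfl
    rw [hz'] at hb
    simp only [Set.mem_iUnion, exists_prop, Finset.mem_image, Finset.mem_product]
    refine ⟨_, ⟨(z 0, z 1, z 2), ⟨?_, hF _ _ ?_ ?_⟩, rfl⟩, fun i => (hb i).2⟩
    · have := (hb 0).1
      simp only [eigenMatrix_mulVec, Matrix.cons_val, abs_le] at this
      rwa [Finset.mem_Icc, Int.ceil_le, Int.le_floor]
    · simpa [eigenMatrix_mulVec] using (hb 1).1
    · simpa [eigenMatrix_mulVec] using (hb 2).1

theorem dimH_eigenRecSet_le_of_merge (hc : c ≠ 0) (hl : 1 < l) (hml : l < m) (hτ : 0 < τ)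
    (hC : 0 < C) {t : ℝ} (ht : 0 < t) :
    dimH (eigenRecSet (eigenMatrix a c l) ![m, l, l⁻¹] τ C) ≤
      ENNReal.ofReal ((Real.log l +
        ∑ i, max 0 (t - (![0, Real.log l + τ, τ] : Fin 3 → ℝ) i)) / t) := by
  refine dimH_eigenRecSet_le_of_window fun W => ?_
  have hli : l⁻¹ < 1 := inv_lt_one_of_one_lt₀ hl
  have hli0 : 0 < 1 - l⁻¹ := sub_pos.2 hli
  have hlog := Real.log_pos hl
  obtain ⟨C', hC', hF⟩ := exists_finset_int_prod (α := c) (β := l - a) (β' := l⁻¹ - a)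
    (V := W + C) (Int.cast_ne_zero.2 hc) (by linarith) (by positivity)
  refine dimH_frequently_mem_le_of_boxes _ _ (K := max W (C / (1 - l⁻¹)))
    hC' (le_max_of_le_left W.cast_nonneg) ht ?_
  filter_upwards [eventually_ge_atTop 1] with n hn
  obtain ⟨F, hFc, hF⟩ := hF (Real.exp (n * Real.log l)) (Real.one_le_exp (by positivity))
  refine ⟨F.image fun q => ![0, (c * q.1 + (l - a) * q.2) / (l ^ n - 1),
    (c * q.1 + (l⁻¹ - a) * q.2) / (l⁻¹ ^ n - 1)],
    (Nat.cast_le.2 Finset.card_image_le).trans hFc, ?_⟩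
  rintro w ⟨hw, z, hz⟩
  have hb := fun i => abs_le_of_abs_eigen_lt hl hml hτ hC hn (hw i) (hz i)
  simp only [Set.mem_iUnion, exists_prop, Finset.mem_image]
  have h1 := hb 1
  have h2 := hb 2
  simp only [eigenMatrix_mulVec, Matrix.cons_val, mul_zero, Real.exp_zero, mul_one,
    zero_add] at h1 h2
  refine ⟨_, ⟨(z 1, z 2), hF _ _ h1.1 h2.1, rfl⟩, fun i => ?_⟩
  fin_cases i
  · simpa using Or.inl (hw 0)
  · exact h1.2.trans (mul_le_mul_of_nonneg_right (le_max_right _ _) (Real.exp_pos _).le)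
  · exact h2.2.trans (mul_le_mul_of_nonneg_right (le_max_right _ _) (Real.exp_pos _).le)

theorem dimH_eigenRecSet_le_min (hc : c ≠ 0) (hl : 1 < l) (hml : l < m) (hτ : 0 < τ)
    (hC : 0 < C) :
    dimH (eigenRecSet (eigenMatrix a c l) ![m, l, l⁻¹] τ C) ≤
      ENNReal.ofReal (min ((τ + 3 * Real.log l) / (τ + Real.log l))
          (min (3 * Real.log m / (τ + Real.log m))
            (min ((2 * Real.log l + Real.log m) / (τ + Real.log l))
              (min ((Real.log l + Real.log m) / τ)
                ((τ + Real.log l) / τ))))) := by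
  have hL := Real.log_pos hl
  have hLM : Real.log l < Real.log m := Real.log_lt_log (by linarith) hml
  have hM := hL.trans hLM
  have unmerged := fun {t : ℝ} (ht : 0 < t) => dimH_eigenRecSet_le (a := a) hc hl hml hτ hC ht
  have merged := fun {t : ℝ} (ht : 0 < t) => dimH_eigenRecSet_le_of_merge (a := a) hc hl hml hτ hC ht
  simp only [Fin.sum_univ_three, Matrix.cons_val, zero_add, sub_zero] at unmerged merged
  simp only [ENNReal.ofReal_min, le_min_iff]
  refine ⟨?_, ?_, ?_, ?_, ?_⟩
  · refine (merged (by linarith : 0 < τ + Real.log l)).trans_eq ?_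
    congr 2
    rw [max_eq_right (by linarith), max_eq_left (by linarith), max_eq_right (by linarith)]
    ring
  · refine (unmerged (by linarith : 0 < τ + Real.log m)).trans_eq ?_
    congr 2
    rw [max_eq_left (by linarith), max_eq_right (by linarith), max_eq_right (by linarith)]
    ring
  · refine (unmerged (by linarith : 0 < τ + Real.log l)).trans_eq ?_
    congr 2
    rw [max_eq_left (by linarith), max_eq_left (by linarith), max_eq_right (by linarith)]
    ring
  · refine (unmerged hτ).trans_eq ?_
    congr 2
    rw [max_eq_left (by linarith), max_eq_left (by linarith), max_eq_left (by linarith)]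
    ring
  · refine (merged hτ).trans_eq ?_
    congr 2
    rw [max_eq_right (by linarith), max_eq_left (by linarith), max_eq_left (by linarith)]
    ring

theorem exists_int_abs_linear_sub_le {α β β' : ℝ} (hα : α ≠ 0) (hβ : β ≠ β') :
    ∃ K, 0 < K ∧ ∀ u v : ℝ, ∃ x y : ℤ, |α * x + β * y - u| ≤ K ∧ |α * x + β' * y - v| ≤ K := by
  have hβ0 : β - β' ≠ 0 := sub_ne_zero.2 hβ
  have hα' : 0 < |α| := abs_pos.2 hα
  refine ⟨|α| + |β| + |β'|, by positivity, fun u v => ?_⟩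
  set y₀ := (u - v) / (β - β') with hy₀
  set x₀ := (u - β * y₀) / α with hx₀
  have h1 : α * x₀ + β * y₀ = u := by rw [hx₀]; field_simp; ring
  have h2 : α * x₀ + β' * y₀ = v := by
    have : (β - β') * y₀ = u - v := by rw [hy₀]; field_simp
    linarith
  have key : ∀ b : ℝ, |α * round x₀ + b * round y₀ - (α * x₀ + b * y₀)| ≤ |α| + |b| := by
    intro b
    calc |α * round x₀ + b * round y₀ - (α * x₀ + b * y₀)| =
        |α * (x₀ - round x₀) + b * (y₀ - round y₀)| := by rw [← abs_neg]; congr 1; ring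
      _ ≤ |α| * |x₀ - round x₀| + |b| * |y₀ - round y₀| := by
          rw [← abs_mul, ← abs_mul]; exact abs_add_le _ _
      _ ≤ |α| * 1 + |b| * 1 := by
          gcongr
          · exact (abs_sub_round _).trans (by norm_num)
          · exact (abs_sub_round _).trans (by norm_num)
      _ = _ := by ring
  refine ⟨round x₀, round y₀, ?_, ?_⟩
  · have := key β
    rw [h1] at this
    linarith [abs_nonneg β']
  · have := key β'
    rw [h2] at this
    linarith [abs_nonneg β]

theorem eigen_mul_of_root {a b c d : ℤ} {x : ℝ} (hdet : a * d - b * c = 1)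
    (hx : x ^ 2 - ((a : ℝ) + d) * x + 1 = 0) (u v : ℝ) :
    c * (a * u + b * v) + (x - a) * (c * u + d * v) = x * (c * u + (x - a) * v) := by
  have hdet' : (a : ℝ) * d - b * c = 1 := by exact_mod_cast hdet
  linear_combination -v * hx - v * hdet'

theorem exists_int_eigen_eq_pow_mul {a b c d : ℤ} {l l' : ℝ} (hdet : a * d - b * c = 1)
    (hl : l ^ 2 - ((a : ℝ) + d) * l + 1 = 0) (hl' : l' ^ 2 - ((a : ℝ) + d) * l' + 1 = 0)
    (j : ℕ) (x y : ℤ) : ∃ x' y' : ℤ,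
      c * (x' : ℝ) + (l - a) * y' = l ^ j * (c * x + (l - a) * y) ∧
      c * (x' : ℝ) + (l' - a) * y' = l' ^ j * (c * x + (l' - a) * y) := by
  induction j with
  | zero => exact ⟨x, y, by simp, by simp⟩
  | succ j ih =>
    obtain ⟨x', y', h1, h2⟩ := ih
    refine ⟨a * x' + b * y', c * x' + d * y', ?_, ?_⟩
    · push_cast
      rw [eigen_mul_of_root hdet hl, h1]; ring
    · push_cast
      rw [eigen_mul_of_root hdet hl', h2]; ring

theorem inv_root {l q : ℝ} (hl0 : l ≠ 0) (hl : l ^ 2 - q * l + 1 = 0) :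
    l⁻¹ ^ 2 - q * l⁻¹ + 1 = 0 := by
  field_simp
  linarith

theorem exists_int_abs_eigen_sub_le {a b c d : ℤ} {l : ℝ} (hdet : a * d - b * c = 1) (hc : c ≠ 0)
    (hl1 : 1 < l) (hl : l ^ 2 - ((a : ℝ) + d) * l + 1 = 0) :
    ∃ K, 0 < K ∧ ∀ R : ℝ, 1 ≤ R → ∀ u v : ℝ, ∃ x y : ℤ,
      |c * (x : ℝ) + (l - a) * y - u| ≤ K * R ∧ |c * (x : ℝ) + (l⁻¹ - a) * y - v| ≤ K * R⁻¹ := by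
  have hl0 : 0 < l := by linarith
  have hli : l⁻¹ < 1 := inv_lt_one_of_one_lt₀ hl1
  obtain ⟨K, hK, h⟩ := exists_int_abs_linear_sub_le (α := c) (β := l - a) (β' := l⁻¹ - a)
    (Int.cast_ne_zero.2 hc) (by linarith)
  refine ⟨K * l, by positivity, fun R hR u v => ?_⟩
  obtain ⟨j, hj1, hj2⟩ := exists_nat_pow_near hR hl1
  obtain ⟨x, y, h1, h2⟩ := h (l⁻¹ ^ j * u) (l ^ j * v)
  obtain ⟨x', y', h1', h2'⟩ := exists_int_eigen_eq_pow_mul hdet hl (inv_root hl0.ne' hl) j x y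
  have hjj : l ^ j * l⁻¹ ^ j = 1 := by rw [← mul_pow, mul_inv_cancel₀ hl0.ne', one_pow]
  refine ⟨x', y', ?_, ?_⟩
  · rw [h1', show l ^ j * (c * x + (l - a) * y) - u =
      l ^ j * (c * x + (l - a) * y - l⁻¹ ^ j * u) by linear_combination u * hjj,
      abs_mul, abs_of_pos (by positivity)]
    calc l ^ j * |c * x + (l - a) * y - l⁻¹ ^ j * u| ≤ R * K := by gcongr
      _ ≤ R * K * l := le_mul_of_one_le_right (by positivity) hl1.le
      _ = _ := by ring
  · rw [h2', show l⁻¹ ^ j * (c * x + (l⁻¹ - a) * y) - v =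
      l⁻¹ ^ j * (c * x + (l⁻¹ - a) * y - l ^ j * v) by linear_combination v * hjj,
      abs_mul, abs_of_pos (by positivity)]
    have h3 : l⁻¹ ^ j ≤ l * R⁻¹ := by
      rw [inv_pow, ← div_eq_mul_inv, le_div_iff₀ (by positivity), inv_mul_le_iff₀ (by positivity),
        ← pow_succ]
      exact hj2.le
    calc l⁻¹ ^ j * |c * x + (l⁻¹ - a) * y - l ^ j * v| ≤ l * R⁻¹ * K := by gcongr
      _ = _ := by ring

theorem exists_pi_int_eigenMatrix_sub_le {a b c d : ℤ} {l : ℝ} (hdet : a * d - b * c = 1)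
    (hc : c ≠ 0) (hl1 : 1 < l) (hl : l ^ 2 - ((a : ℝ) + d) * l + 1 = 0) :
    ∃ K, 1 ≤ K ∧ ∀ R : ℝ, 1 ≤ R → ∀ u : Fin 3 → ℝ, ∃ z : Fin 3 → ℤ, ∀ i,
      |(eigenMatrix a c l).mulVec (fun j => (z j : ℝ)) i - u i| ≤
        K * (![1, R, R⁻¹] : Fin 3 → ℝ) i := by
  obtain ⟨K, hK, h⟩ := exists_int_abs_eigen_sub_le hdet hc hl1 hl
  refine ⟨max 1 K, le_max_left _ _, fun R hR u => ?_⟩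
  obtain ⟨x, y, h1, h2⟩ := h R hR (u 1) (u 2)
  have hR0 : 0 < R := by linarith
  refine ⟨![round (u 0), x, y], fun i => ?_⟩
  rw [eigenMatrix_mulVec]
  fin_cases i
  · rw [abs_sub_comm]
    exact (abs_sub_round _).trans ((by norm_num : (1 : ℝ) / 2 ≤ 1).trans (by simp))
  · exact h1.trans (mul_le_mul_of_nonneg_right (le_max_right _ _) hR0.le)
  · exact h2.trans (mul_le_mul_of_nonneg_right (le_max_right _ _) (inv_pos.2 hR0).le)

theorem le_dimH_eigenRecSet {b d : ℤ} (hdet : a * d - b * c = 1) (hc : c ≠ 0) (hl1 : 1 < l)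
    (hl : l ^ 2 - ((a : ℝ) + d) * l + 1 = 0) (hml : l < m) (hτ : 0 < τ) (hC : 0 < C) :
    ENNReal.ofReal (min ((τ + 3 * Real.log l) / (τ + Real.log l))
          (min (3 * Real.log m / (τ + Real.log m))
            (min ((2 * Real.log l + Real.log m) / (τ + Real.log l))
              (min ((Real.log l + Real.log m) / τ)
                ((τ + Real.log l) / τ))))) ≤
      dimH (eigenRecSet (eigenMatrix a c l) ![m, l, l⁻¹] τ C) := by
  have hL := Real.log_pos hl1
  have hLM : Real.log l < Real.log m := Real.log_lt_log (by linarith) hml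
  set s' := (min ((τ + 3 * Real.log l) / (τ + Real.log l))
          (min (3 * Real.log m / (τ + Real.log m))
            (min ((2 * Real.log l + Real.log m) / (τ + Real.log l))
              (min ((Real.log l + Real.log m) / τ)
                ((τ + Real.log l) / τ))))) with hs'
  set L := Real.log l with hLdef
  set M := Real.log m with hMdef
  obtain ⟨h1, h2, h3, h4, h5⟩ : s' * (τ + L) ≤ τ + 3 * L ∧ s' * (τ + M) ≤ 3 * M ∧
      s' * (τ + L) ≤ 2 * L + M ∧ s' * τ ≤ L + M ∧ s' * τ ≤ τ + L := by
    have := hs'.le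
    simp only [le_min_iff] at this
    rwa [le_div_iff₀ (by linarith), le_div_iff₀ (by linarith), le_div_iff₀ (by linarith),
      le_div_iff₀ (by linarith), le_div_iff₀ (by linarith)] at this
  refine le_of_forall_lt_imp_le_of_dense fun x hx => ?_
  lift x to NNReal using (hx.trans_le le_top).ne
  rcases eq_or_ne x 0 with rfl | hx0
  · simp
  have hxs : (x : ℝ) < s' := by
    rw [← ENNReal.ofReal_coe_nnreal] at hx
    exact (ENNReal.ofReal_lt_ofReal_iff'.1 hx).1
  have hli : l⁻¹ < 1 := inv_lt_one_of_one_lt₀ hl1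
  have hli0 : 0 < 1 - l⁻¹ := sub_pos.2 hli
  obtain ⟨K₀, hK₀, hlat⟩ := exists_pi_int_eigenMatrix_sub_le hdet hc hl1 hl
  set σ := min τ (L / 2) with hσ
  have hσ0 : 0 < σ := lt_min hτ (by positivity)
  have hστ : σ ≤ τ := min_le_left _ _
  have hσL : σ ≤ L / 2 := min_le_right _ _
  set E : Fin 3 → ℝ := ![M, L, 0] with hE
  set v : Fin 3 → ℝ := ![0, σ, -σ] with hv
  set K := 2 * K₀ / (1 - l⁻¹) with hK
  have hK1 : 1 ≤ K := by
    rw [hK, le_div_iff₀ hli0]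
    have : 0 < l⁻¹ := by positivity
    linarith
  have hEv : ∀ i, σ ≤ E i - v i := by
    intro i
    fin_cases i <;> simp [hE, hv] <;> linarith
  have hvτ : ∀ i, E i - v i ≤ E i + τ := by
    intro i
    fin_cases i <;> simp [hv] <;> linarith
  set κ := min 1 (C / 2) with hκ
  have hκ0 : 0 < κ := lt_min one_pos (by positivity)
  have hκ1 : κ ≤ 1 := min_le_left _ _
  have hκC : κ < C := (min_le_right _ _).trans_lt (by linarith)
  refine le_dimH_frequently_mem_of_box_subset
    (fun n => {w | ∃ z : Fin 3 → ℤ, ∀ i, |((![(m : ℝ), l, l⁻¹] : Fin 3 → ℝ) i ^ n - 1) * w i -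
      (eigenMatrix a c l).mulVec (fun j => (z j : ℝ)) i| < C * Real.exp (-n * τ)})
    (fun n i => K * Real.exp (-n * (E i - v i))) (fun n i => κ * Real.exp (-n * (E i + τ)))
    (fun n => K * Real.exp (-n * σ)) (pos_iff_ne_zero.2 hx0) (fun n i => by positivity)
    (fun n i => ?_) (fun n i => ?_) ?_ ?_ ?_
  · refine mul_le_mul (hκ1.trans hK1) (Real.exp_le_exp.2 ?_) (Real.exp_pos _).le (by linarith)
    have := mul_le_mul_of_nonneg_left (hvτ i) n.cast_nonneg (α := ℝ)
    linarith
  · refine mul_le_mul_of_nonneg_left (Real.exp_le_exp.2 ?_) (by linarith)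
    have := mul_le_mul_of_nonneg_left (hEv i) n.cast_nonneg (α := ℝ)
    linarith
  · rw [← mul_zero K]
    refine (Real.tendsto_exp_atBot.comp ?_).const_mul K
    simp only [neg_mul]
    exact tendsto_neg_atTop_atBot.comp (tendsto_natCast_atTop_atTop.atTop_mul_const hσ0)
  · filter_upwards [eventually_ge_atTop 1] with n hn q
    have hb := eigenvalue_pow_sub_one_bounds hl1 hml hn
    rw [← hE] at hb
    set y : Fin 3 → ℝ := fun i => (![(m : ℝ), l, l⁻¹] : Fin 3 → ℝ) i ^ n - 1 with hy
    have hy0 : ∀ i, 0 < |y i| := fun i => lt_of_lt_of_le (by positivity) (hb i).1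
    have hy1 : ∀ i, y i ≠ 0 := fun i => abs_pos.1 (hy0 i)
    obtain ⟨z, hz⟩ := hlat (Real.exp (n * σ)) (Real.one_le_exp (by positivity))
      fun i => y i * (q i + K * Real.exp (-n * (E i - v i)) / 2)
    have hvR : ∀ i, (![1, Real.exp (n * σ), (Real.exp (n * σ))⁻¹] : Fin 3 → ℝ) i =
        Real.exp (n * v i) := by
      intro i
      fin_cases i <;> simp [hv, Real.exp_neg]
    set γ := (eigenMatrix a c l).mulVec (fun j => (z j : ℝ)) with hγ
    refine ⟨fun i => γ i / y i, fun i => ?_, fun w hw => ⟨z, fun i => ?_⟩⟩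
    · have h6 : |γ i / y i - (q i + K * Real.exp (-n * (E i - v i)) / 2)| ≤
          K * Real.exp (-n * (E i - v i)) / 2 := by
        refine le_of_mul_le_mul_right ?_ (hy0 i)
        rw [← abs_mul, sub_mul, div_mul_cancel₀ _ (hy1 i), mul_comm _ (y i)]
        refine (hz i).trans ?_
        rw [hvR]
        calc K₀ * Real.exp (n * v i) = K * Real.exp (-n * (E i - v i)) / 2 *
            ((1 - l⁻¹) * Real.exp (n * E i)) := by
              rw [show (n : ℝ) * v i = -n * (E i - v i) + n * E i by ring, Real.exp_add]
              have : K * (1 - l⁻¹) = 2 * K₀ := div_mul_cancel₀ _ hli0.ne'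
              linear_combination (-1 / 2 * Real.exp (-n * (E i - v i)) * Real.exp (n * E i)) * this
          _ ≤ _ := by
              have := (hb i).1
              gcongr
      rw [abs_le] at h6
      constructor <;> linarith
    · change |y i * w i - γ i| < _
      rw [show y i * w i - γ i = y i * (w i - γ i / y i) by have := hy1 i; field_simp, abs_mul]
      calc |y i| * |w i - γ i / y i| ≤
          Real.exp (n * E i) * (κ * Real.exp (-n * (E i + τ))) := by
            gcongr
            · exact (hb i).2
            · exact hw i
        _ = κ * Real.exp (-n * τ) := by
            rw [show -(n : ℝ) * τ = n * E i + -n * (E i + τ) by ring, Real.exp_add]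
            ring
        _ < _ := by gcongr
  · refine eventually_mul_prod_max_mul_min_le (fun i => E i - v i) (fun i => E i + τ)
      hK1 hκ0 hκ1 hσ0 hxs fun t ht => ?_
    refine (mul_le_sum_min_add_sum_max hL hLM hτ ht h1 h2 h3 h4 h5).trans_eq ?_
    simp [Fin.sum_univ_three, hE, hv, hσ]

end EigenRecSet

/-- Example, case `m > λ`: for `A = [[m,0,0],[0,a,b],[0,c,d]]` with `m > 1`,
`ad - bc = 1`, block eigenvalue `λ > 1` and `m > λ`,
`dim_H R_τ = min{(τ+3logλ)/(τ+logλ), 3log m/(τ+log m),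
(2logλ+log m)/(τ+logλ), (logλ+log m)/τ, (τ+logλ)/τ}`. -/
theorem dimH_recSet3_of_lt (m a b c d : ℤ) (hm : 1 < m)
    (hdet : a * d - b * c = 1) (l : ℝ) (hl1 : 1 < l)
    (hl : l ^ 2 - ((a : ℝ) + d) * l + 1 = 0) (hml : (l : ℝ) < m)
    (τ : ℝ) (hτ : 0 < τ) :
    dimH (recSet3 ![![m, 0, 0], ![0, a, b], ![0, c, d]] τ)
      = ENNReal.ofReal (min ((τ + 3 * Real.log l) / (τ + Real.log l))
          (min (3 * Real.log m / (τ + Real.log m))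
            (min ((2 * Real.log l + Real.log m) / (τ + Real.log l))
              (min ((Real.log l + Real.log m) / τ)
                ((τ + Real.log l) / τ))))) := by
  have hl0 : 0 < l := by linarith
  have hli : l⁻¹ < 1 := inv_lt_one_of_one_lt₀ hl1
  have hc : c ≠ 0 := by
    rintro rfl
    have had : a * d = 1 := by linarith
    have hsum : ((a : ℝ) + d) ≤ 2 := by
      rcases Int.mul_eq_one_iff_eq_one_or_neg_one.1 had with ⟨rfl, rfl⟩ | ⟨rfl, rfl⟩ <;> norm_num
    nlinarith [sq_nonneg (l - 1)]
  have hdetP : (eigenMatrix a c l).det ≠ 0 := by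
    rw [show (eigenMatrix a c l).det = c * (l⁻¹ - l) by
      simp [eigenMatrix, Matrix.det_fin_three]; ring]
    exact mul_ne_zero (Int.cast_ne_zero.2 hc) (by linarith)
  have hAP : eigenMatrix a c l * Matrix.map ![![m, 0, 0], ![0, a, b], ![0, c, d]]
      (Int.cast : ℤ → ℝ) = Matrix.diagonal ![(m : ℝ), l, l⁻¹] * eigenMatrix a c l := by
    have hmap : Matrix.map ![![m, 0, 0], ![0, a, b], ![0, c, d]] (Int.cast : ℤ → ℝ) =
        !![(m : ℝ), 0, 0; 0, a, b; 0, c, d] := by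
      ext i j
      fin_cases i <;> fin_cases j <;> simp [Matrix.map, Matrix.of_apply]
    have h10 : ∀ {x : ℝ}, x ^ 2 - ((a : ℝ) + d) * x + 1 = 0 → c * (a : ℝ) + (x - a) * c = x * c :=
      fun hx => by simpa using eigen_mul_of_root hdet hx 1 0
    have h01 : ∀ {x : ℝ}, x ^ 2 - ((a : ℝ) + d) * x + 1 = 0 →
        c * (b : ℝ) + (x - a) * d = x * (x - a) :=
      fun hx => by simpa using eigen_mul_of_root hdet hx 0 1
    rw [hmap]
    ext i j
    fin_cases i <;> fin_cases j <;>
      simp [eigenMatrix, Matrix.mul_apply, Fin.sum_univ_three, h10 hl, h01 hl,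
        h10 (inv_root hl0.ne' hl), h01 (inv_root hl0.ne' hl)]
  obtain ⟨⟨C₁, hC₁, h₁⟩, C₂, hC₂, h₂⟩ := exists_dimH_eigenRecSet_le_and_le τ hdetP hAP
  exact le_antisymm (h₂.trans (dimH_eigenRecSet_le_min hc hl1 hml hτ hC₂))
    ((le_dimH_eigenRecSet hdet hc hl1 hl hml hτ hC₁).trans h₁)
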